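/- arXiv:0902.1026 — 2 statements merged into one kernel-verified Lean document; each statement's English description precedes it below -/
import Mathlib

section
/- In the random-environment setup with a stationary, ergodic random environment η and a random walk X in the 'have your cookie and eat it' environment η started at 1, the following dichotomy holds: either P(T_0 = ∞) = 0, or the conditional probability E[1_{{T_0 = ∞}} | σ(η)] is almost surely strictly positive (i.e., for almost every realization of the environment, the quenched probability of never hitting 0 is positive). -/
open MeasureTheory Filter

noncomputable section

/-- The hitting time of site `x` by the process `X`, with value `⊤` if `x` is never hit. -/
def hitTime {Ω : Type*} (X : ℕ → Ω → ℤ) (x : ℤ) (ω : Ω) : ℕ∞ :=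
  ⨅ (n : ℕ) (_ : X n ω = x), (n : ℕ∞)

/-- The natural filtration of the process `X` at time `n`. -/
def natSA {Ω : Type*} (X : ℕ → Ω → ℤ) (n : ℕ) : MeasurableSpace Ω :=
  ⨆ m ∈ Finset.range (n + 1), MeasurableSpace.comap (X m) ⊤

/-- The event `A_n` that before time `n` the walk has never jumped leftward from its
current site `X_n`. -/
def freshEvent {Ω : Type*} (X : ℕ → Ω → ℤ) (n : ℕ) : Set Ω :=
  {ω | ∀ m < n, ¬(X m ω = X n ω ∧ X (m + 1) ω = X m ω - 1)}

/-- A random walk in the "have your cookie and eat it" environment `env`. -/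
structure IsCookieRW {Ω : Type*} [MeasurableSpace Ω] (P : Measure Ω)
    (env : ℤ → ℝ) (X : ℕ → Ω → ℤ) : Prop where
  envRange : ∀ x : ℤ, env x ∈ Set.Ico (1 / 2 : ℝ) 1
  meas : ∀ n, Measurable (X n)
  steps : ∀ n : ℕ, ∀ᵐ ω ∂P, |X (n + 1) ω - X n ω| = 1
  cond : ∀ n : ℕ,
    (P[Set.indicator {ω | X (n + 1) ω = X n ω + 1} (fun _ => (1 : ℝ)) | natSA X n])
      =ᵐ[P]
    fun ω => env (X n ω) * Set.indicator (freshEvent X n) (fun _ => (1 : ℝ)) ω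
      + (1 / 2) * Set.indicator (freshEvent X n)ᶜ (fun _ => (1 : ℝ)) ω

/-- A random walk in a random "have your cookie and eat it" environment `η`. -/
structure IsCookieRWRE {Ω : Type*} [MeasurableSpace Ω] (P : Measure Ω)
    (η : Ω → ℤ → ℝ) (X : ℕ → Ω → ℤ) : Prop where
  envMeas : Measurable η
  envRange : ∀ᵐ ω ∂P, ∀ x : ℤ, η ω x ∈ Set.Ico (1 / 2 : ℝ) 1
  meas : ∀ n, Measurable (X n)
  steps : ∀ n : ℕ, ∀ᵐ ω ∂P, |X (n + 1) ω - X n ω| = 1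
  cond : ∀ n : ℕ,
    (P[Set.indicator {ω | X (n + 1) ω = X n ω + 1} (fun _ => (1 : ℝ)) |
        MeasurableSpace.comap η inferInstance ⊔ natSA X n])
      =ᵐ[P]
    fun ω => η ω (X n ω) * Set.indicator (freshEvent X n) (fun _ => (1 : ℝ)) ω
      + (1 / 2) * Set.indicator (freshEvent X n)ᶜ (fun _ => (1 : ℝ)) ω

/-- The probability of a right jump from `x` when `S` is the set of sites already left to the left,
with the environment truncated to `[1/2, 1]`. -/
def rightProb (e : ℤ → ℝ) (x : ℤ) (S : Set ℤ) : ℝ :=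
  open Classical in if x ∈ S then 1 / 2 else max (1 / 2) (min (e x) 1)

/-- The probability that the cookie walk in environment `e`, currently at `x` and having already
jumped leftward exactly from the sites in `S`, stays above `a` during its next `n` steps. -/
def avoidProb (e : ℤ → ℝ) (a : ℤ) : ℕ → ℤ → Set ℤ → ℝ
  | 0, _, _ => 1
  | n + 1, x, S => rightProb e x S * avoidProb e a n (x + 1) S +
      (1 - rightProb e x S) * (if a < x - 1 then avoidProb e a n (x - 1) (insert x S) else 0)

lemma half_le_rightProb (e : ℤ → ℝ) (x : ℤ) (S : Set ℤ) : 1 / 2 ≤ rightProb e x S := by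
  unfold rightProb
  split_ifs
  · exact le_rfl
  · exact le_max_left _ _

lemma rightProb_le_one (e : ℤ → ℝ) (x : ℤ) (S : Set ℤ) : rightProb e x S ≤ 1 := by
  unfold rightProb
  split_ifs
  · norm_num
  · exact max_le (by norm_num) (min_le_right _ _)

lemma avoidProb_nonneg (e : ℤ → ℝ) (a : ℤ) (n : ℕ) (x : ℤ) (S : Set ℤ) :
    0 ≤ avoidProb e a n x S := by
  induction n generalizing x S with
  | zero => exact zero_le_one
  | succ n ih =>
    have h1 := half_le_rightProb e x S
    have h2 := rightProb_le_one e x S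
    refine add_nonneg (mul_nonneg (by linarith) (ih _ _)) (mul_nonneg (by linarith) ?_)
    split_ifs
    · exact ih _ _
    · exact le_rfl

lemma avoidProb_succ_le (e : ℤ → ℝ) (a : ℤ) (n : ℕ) (x : ℤ) (S : Set ℤ) :
    avoidProb e a (n + 1) x S ≤ avoidProb e a n x S := by
  induction n generalizing x S with
  | zero =>
    have h1 := half_le_rightProb e x S
    have h2 := rightProb_le_one e x S
    simp only [avoidProb]
    split_ifs <;> linarith
  | succ n ih =>
    have h1 := half_le_rightProb e x S
    have h2 := rightProb_le_one e x S
    rw [avoidProb, avoidProb.eq_2 e a x S n]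
    refine add_le_add (mul_le_mul_of_nonneg_left (ih _ _) (by linarith))
      (mul_le_mul_of_nonneg_left ?_ (by linarith))
    split_ifs
    · exact ih _ _
    · exact le_rfl

lemma antitone_avoidProb (e : ℤ → ℝ) (a : ℤ) (x : ℤ) (S : Set ℤ) :
    Antitone fun n => avoidProb e a n x S :=
  antitone_nat_of_succ_le fun n => avoidProb_succ_le e a n x S

lemma avoidProb_le_one (e : ℤ → ℝ) (a : ℤ) (n : ℕ) (x : ℤ) (S : Set ℤ) :
    avoidProb e a n x S ≤ 1 :=
  antitone_avoidProb e a x S (Nat.zero_le n)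

lemma avoidProb_anti_level (e : ℤ → ℝ) {a b : ℤ} (hab : a ≤ b) (n : ℕ) (x : ℤ) (S : Set ℤ) :
    avoidProb e b n x S ≤ avoidProb e a n x S := by
  induction n generalizing x S with
  | zero => exact le_rfl
  | succ n ih =>
    have h1 := half_le_rightProb e x S
    have h2 := rightProb_le_one e x S
    rw [avoidProb, avoidProb]
    refine add_le_add (mul_le_mul_of_nonneg_left (ih _ _) (by linarith))
      (mul_le_mul_of_nonneg_left ?_ (by linarith))
    split_ifs
    · exact ih _ _
    · omega
    · exact avoidProb_nonneg _ _ _ _ _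
    · exact le_rfl

lemma avoidProb_shift (e : ℤ → ℝ) (a : ℤ) (n : ℕ) (x : ℤ) (S : Set ℤ) :
    avoidProb (fun y => e (y + 1)) a n x ((· + 1) ⁻¹' S) = avoidProb e (a + 1) n (x + 1) S := by
  induction n generalizing x S with
  | zero => rfl
  | succ n ih =>
    have hp : rightProb (fun y => e (y + 1)) x ((· + 1) ⁻¹' S) = rightProb e (x + 1) S := rfl
    have hins : insert x ((· + 1) ⁻¹' S) = (· + 1) ⁻¹' (insert (x + 1) S) := by
      ext y
      simp
    have hx : x - 1 + 1 = x + 1 - 1 := by ring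
    have hlt : a < x - 1 ↔ a + 1 < x + 1 - 1 := by omega
    rw [avoidProb, avoidProb, hp, hins, ih, ih, hx]
    simp only [hlt]

lemma avoidProb_shift_le (e : ℤ → ℝ) (n : ℕ) :
    1 / 2 * avoidProb (fun y => e (y + 1)) 0 n 1 ∅ ≤ avoidProb e 0 (n + 1) 1 ∅ := by
  have h1 := half_le_rightProb e 1 ∅
  have h := avoidProb_shift e 0 n 1 ∅
  rw [Set.preimage_empty] at h
  rw [h, avoidProb]
  have h2 := avoidProb_anti_level e (zero_le_one : (0 : ℤ) ≤ 1) n (1 + 1) ∅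
  have h3 := avoidProb_nonneg e 1 n (1 + 1) ∅
  simp only [zero_add, sub_self, lt_irrefl, if_false, mul_zero, add_zero]
  exact mul_le_mul h1 h2 h3 (by linarith)

lemma measurable_rightProb {Ω : Type*} {_ : MeasurableSpace Ω} {η : Ω → ℤ → ℝ} (hη : Measurable η)
    {x : Ω → ℤ} (hx : Measurable x) {S : Ω → Set ℤ} (hS : ∀ y, MeasurableSet {ω | y ∈ S ω}) :
    Measurable fun ω => rightProb (η ω) (x ω) (S ω) := by
  have h : Measurable fun p : Ω × ℤ => rightProb (η p.1) p.2 (S p.1) := by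
    refine measurable_from_prod_countable_left fun y => ?_
    have hy : Measurable fun ω => η ω y := (measurable_pi_apply y).comp hη
    exact Measurable.ite (hS y) measurable_const
      (measurable_const.max (hy.min measurable_const))
  exact h.comp (measurable_id.prodMk hx)

lemma measurable_avoidProb {Ω : Type*} {_ : MeasurableSpace Ω} {η : Ω → ℤ → ℝ} (hη : Measurable η)
    (a : ℤ) (n : ℕ) {x : Ω → ℤ} (hx : Measurable x) {S : Ω → Set ℤ}
    (hS : ∀ y, MeasurableSet {ω | y ∈ S ω}) :
    Measurable fun ω => avoidProb (η ω) a n (x ω) (S ω) := by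
  induction n generalizing x S with
  | zero => exact measurable_const
  | succ n ih =>
    have hp := measurable_rightProb hη hx hS
    have hins : ∀ y, MeasurableSet {ω | y ∈ insert (x ω) (S ω)} := fun y =>
      (measurableSet_eq_fun measurable_const hx).union (hS y)
    have hx' : Measurable fun ω => x ω - 1 := hx.sub_const 1
    exact (hp.mul (ih (hx.add_const 1) hS)).add ((measurable_const.sub hp).mul
      (Measurable.ite (measurableSet_lt measurable_const hx') (ih hx' hins) measurable_const))

lemma measurable_avoidProb_right {Ω : Type*} {_ : MeasurableSpace Ω} {η : Ω → ℤ → ℝ}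
    (hη : Measurable η) (a : ℤ) (n : ℕ) {x : Ω → ℤ} (hx : Measurable x) {S : Ω → Set ℤ}
    (hS : ∀ y, MeasurableSet {ω | y ∈ S ω}) :
    Measurable fun ω => avoidProb (η ω) a n (x ω + 1) (S ω) :=
  measurable_avoidProb hη a n (hx.add_const 1) hS

lemma measurable_avoidProb_left {Ω : Type*} {_ : MeasurableSpace Ω} {η : Ω → ℤ → ℝ}
    (hη : Measurable η) (a : ℤ) (n : ℕ) {x : Ω → ℤ} (hx : Measurable x) {S : Ω → Set ℤ}
    (hS : ∀ y, MeasurableSet {ω | y ∈ S ω}) :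
    Measurable fun ω => if a < x ω - 1 then avoidProb (η ω) a n (x ω - 1) (insert (x ω) (S ω))
      else 0 := by
  have hx' : Measurable fun ω => x ω - 1 := hx.sub_const 1
  exact Measurable.ite (measurableSet_lt measurable_const hx')
    (measurable_avoidProb hη a n hx' fun y =>
      (measurableSet_eq_fun measurable_const hx).union (hS y)) measurable_const

/-- The probability that the cookie walk in environment `e` started at `1` stays positive. -/
def escapeProb (e : ℤ → ℝ) : ℝ := ⨅ n, avoidProb e 0 n 1 ∅

lemma bddBelow_avoidProb (e : ℤ → ℝ) (a x : ℤ) (S : Set ℤ) :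
    BddBelow (Set.range fun n => avoidProb e a n x S) :=
  ⟨0, Set.forall_mem_range.2 fun n => avoidProb_nonneg e a n x S⟩

lemma tendsto_avoidProb (e : ℤ → ℝ) :
    Tendsto (fun n => avoidProb e 0 n 1 ∅) atTop (nhds (escapeProb e)) :=
  tendsto_atTop_ciInf (antitone_avoidProb e 0 1 ∅) (bddBelow_avoidProb e 0 1 ∅)

lemma escapeProb_nonneg (e : ℤ → ℝ) : 0 ≤ escapeProb e :=
  le_ciInf fun n => avoidProb_nonneg e 0 n 1 ∅

lemma escapeProb_le_one (e : ℤ → ℝ) : escapeProb e ≤ 1 :=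
  ciInf_le (bddBelow_avoidProb e 0 1 ∅) 0

lemma escapeProb_shift_le (e : ℤ → ℝ) :
    1 / 2 * escapeProb (fun y => e (y + 1)) ≤ escapeProb e :=
  le_of_tendsto_of_tendsto' ((tendsto_avoidProb _).const_mul _)
    ((tendsto_avoidProb e).comp (tendsto_add_atTop_nat 1)) (avoidProb_shift_le e)

lemma measurable_escapeProb : Measurable escapeProb :=
  measurable_of_tendsto_metrizable
    (fun n => measurable_avoidProb measurable_id 0 n measurable_const (by simp))
    (tendsto_pi_nhds.2 tendsto_avoidProb)

section Walk

variable {Ω : Type*}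

/-- The set of sites from which the path has jumped leftward before time `k`. -/
def leftSites (X : ℕ → Ω → ℤ) (k : ℕ) (ω : Ω) : Set ℤ :=
  {x | ∃ m < k, X m ω = x ∧ X (m + 1) ω = x - 1}

/-- The event that the path is positive up to time `k`. -/
def positiveUntil (X : ℕ → Ω → ℤ) (k : ℕ) : Set Ω := {ω | ∀ j ≤ k, 1 ≤ X j ω}

lemma mem_freshEvent_iff (X : ℕ → Ω → ℤ) (k : ℕ) (ω : Ω) :
    ω ∈ freshEvent X k ↔ X k ω ∉ leftSites X k ω := by
  simp only [freshEvent, leftSites, Set.mem_ofPred_eq]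
  grind

lemma leftSites_succ_of_right {X : ℕ → Ω → ℤ} {k : ℕ} {ω : Ω} (h : X (k + 1) ω = X k ω + 1) :
    leftSites X (k + 1) ω = leftSites X k ω := by
  ext x
  simp only [leftSites, Set.mem_ofPred_eq]
  constructor
  · rintro ⟨m, hm, h1, h2⟩
    rcases Nat.lt_succ_iff_lt_or_eq.1 hm with hm | rfl
    · exact ⟨m, hm, h1, h2⟩
    · omega
  · rintro ⟨m, hm, h1⟩
    exact ⟨m, by omega, h1⟩

lemma leftSites_succ_of_left {X : ℕ → Ω → ℤ} {k : ℕ} {ω : Ω} (h : X (k + 1) ω = X k ω - 1) :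
    leftSites X (k + 1) ω = insert (X k ω) (leftSites X k ω) := by
  ext x
  simp only [leftSites, Set.mem_ofPred_eq, Set.mem_insert_iff]
  constructor
  · rintro ⟨m, hm, h1, h2⟩
    rcases Nat.lt_succ_iff_lt_or_eq.1 hm with hm | rfl
    · exact Or.inr ⟨m, hm, h1, h2⟩
    · exact Or.inl h1.symm
  · rintro (rfl | ⟨m, hm, h1⟩)
    · exact ⟨k, by omega, rfl, h⟩
    · exact ⟨m, by omega, h1⟩

lemma mem_positiveUntil_succ (X : ℕ → Ω → ℤ) (k : ℕ) (ω : Ω) :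
    ω ∈ positiveUntil X (k + 1) ↔ ω ∈ positiveUntil X k ∧ 1 ≤ X (k + 1) ω := by
  simp only [positiveUntil, Set.mem_ofPred_eq]
  constructor
  · exact fun h => ⟨fun j hj => h j (by omega), h _ le_rfl⟩
  · rintro ⟨h1, h2⟩ j hj
    rcases Nat.le_succ_iff.1 hj with hj | rfl
    · exact h1 j hj
    · exact h2

lemma hitTime_eq_top_iff (X : ℕ → Ω → ℤ) (x : ℤ) (ω : Ω) :
    hitTime X x ω = ⊤ ↔ ∀ n, X n ω ≠ x := by
  simp [hitTime, iInf_eq_top]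

lemma measurable_of_le_natSA (X : ℕ → Ω → ℤ) {j k : ℕ} (hj : j ≤ k) :
    Measurable[natSA X k] (X j) := by
  rw [measurable_iff_comap_le]
  exact le_iSup₂_of_le (f := fun m (_ : m ∈ Finset.range (k + 1)) =>
    MeasurableSpace.comap (X m) ⊤) j (Finset.mem_range.2 (by omega)) le_rfl

lemma measurableSet_mem_leftSites {_ : MeasurableSpace Ω} {X : ℕ → Ω → ℤ} {k : ℕ}
    (hX : ∀ j ≤ k, Measurable (X j)) (y : ℤ) : MeasurableSet {ω | y ∈ leftSites X k ω} := by
  have : {ω | y ∈ leftSites X k ω} =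
      ⋃ m, ⋃ (_ : m < k), {ω | X m ω = y} ∩ {ω | X (m + 1) ω = y - 1} := by
    ext ω
    simp only [leftSites, Set.mem_ofPred_eq, Set.mem_iUnion, Set.mem_inter_iff, exists_prop]
  rw [this]
  exact MeasurableSet.iUnion fun m => MeasurableSet.iUnion fun hm =>
    (measurableSet_eq_fun (hX m hm.le) measurable_const).inter
      (measurableSet_eq_fun (hX (m + 1) hm) measurable_const)

lemma measurableSet_positiveUntil {_ : MeasurableSpace Ω} {X : ℕ → Ω → ℤ} {k : ℕ}
    (hX : ∀ j ≤ k, Measurable (X j)) : MeasurableSet (positiveUntil X k) := by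
  have : positiveUntil X k = ⋂ j, ⋂ (_ : j ≤ k), {ω | 1 ≤ X j ω} := by
    ext ω
    simp [positiveUntil]
  rw [this]
  exact MeasurableSet.iInter fun j => MeasurableSet.iInter fun hj =>
    measurableSet_le measurable_const (hX j hj)

/-- The `σ`-algebra generated by the environment and the path up to time `k`. -/
abbrev pastSA (η : Ω → ℤ → ℝ) (X : ℕ → Ω → ℤ) (k : ℕ) : MeasurableSpace Ω :=
  MeasurableSpace.comap η inferInstance ⊔ natSA X k

/-- The candidate for the conditional probability, given the environment and the path up to time
`k`, of staying positive up to time `k + n`. -/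
def survival (η : Ω → ℤ → ℝ) (X : ℕ → Ω → ℤ) (n k : ℕ) : Ω → ℝ :=
  (positiveUntil X k).indicator fun ω => avoidProb (η ω) 0 n (X k ω) (leftSites X k ω)

lemma measurable_survival [MeasurableSpace Ω] {η : Ω → ℤ → ℝ} (hη : Measurable η)
    {X : ℕ → Ω → ℤ} {k : ℕ} (hX : ∀ j ≤ k, Measurable (X j)) (n : ℕ) :
    Measurable (survival η X n k) :=
  (measurable_avoidProb hη 0 n (hX k le_rfl) (measurableSet_mem_leftSites hX)).indicator
    (measurableSet_positiveUntil hX)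

lemma integrable_of_measurable_of_mem_Icc [MeasurableSpace Ω] {P : Measure Ω}
    [IsProbabilityMeasure P] {f : Ω → ℝ} (hf : Measurable f) {a b : ℝ}
    (h : ∀ ω, f ω ∈ Set.Icc a b) : Integrable f P :=
  Integrable.of_mem_Icc a b hf.aemeasurable (ae_of_all _ h)

lemma survival_mem_Icc (η : Ω → ℤ → ℝ) (X : ℕ → Ω → ℤ) (n k : ℕ) (ω : Ω) :
    survival η X n k ω ∈ Set.Icc 0 1 := by
  unfold survival Set.indicator
  split_ifs
  · exact ⟨avoidProb_nonneg _ _ _ _ _, avoidProb_le_one _ _ _ _ _⟩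
  · simp

lemma survival_zero_left (η : Ω → ℤ → ℝ) (X : ℕ → Ω → ℤ) (k : ℕ) :
    survival η X 0 k = (positiveUntil X k).indicator fun _ => 1 := rfl

/-- A nearest-neighbour path started at `1` avoids `0` forever iff it stays positive. -/
lemma hitTime_zero_eq_top_iff {X : ℕ → Ω → ℤ} {ω : Ω} (h0 : X 0 ω = 1)
    (hs : ∀ n, |X (n + 1) ω - X n ω| = 1) :
    hitTime X 0 ω = ⊤ ↔ ∀ n, 1 ≤ X n ω := by
  rw [hitTime_eq_top_iff]
  refine ⟨fun h n => ?_, fun h n => by have := h n; omega⟩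
  induction n with
  | zero => exact h0.ge
  | succ n ih =>
    have h1 := h (n + 1)
    rcases (abs_eq zero_le_one).1 (hs n) with h2 | h2 <;> omega

lemma IsCookieRWRE.pastSA_le [MeasurableSpace Ω] {P : Measure Ω} {η : Ω → ℤ → ℝ}
    {X : ℕ → Ω → ℤ} (h : IsCookieRWRE P η X) (k : ℕ) :
    pastSA η X k ≤ ‹MeasurableSpace Ω› :=
  sup_le h.envMeas.comap_le (iSup₂_le fun m _ => (h.meas m).comap_le)

variable [MeasurableSpace Ω] {P : Measure Ω} [IsProbabilityMeasure P] {η : Ω → ℤ → ℝ}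
  {X : ℕ → Ω → ℤ}

lemma IsCookieRWRE.integrable_survival (h : IsCookieRWRE P η X) (n k : ℕ) :
    Integrable (survival η X n k) P :=
  integrable_of_measurable_of_mem_Icc
    (measurable_survival h.envMeas (fun j _ => h.meas j) n) (survival_mem_Icc η X n k)

lemma IsCookieRWRE.condExp_survival_past (h : IsCookieRWRE P η X) (n k : ℕ) :
    P[survival η X n (k + 1) | pastSA η X k]
      =ᵐ[P] survival η X (n + 1) k := by
  have hGle := h.pastSA_le k
  have hηG : Measurable[pastSA η X k] η := (comap_measurable η).mono le_sup_left le_rfl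
  have hXG : ∀ j ≤ k, Measurable[pastSA η X k] (X j) := fun j hj =>
    (measurable_of_le_natSA X hj).mono le_sup_right le_rfl
  set R : Ω → ℝ := Set.indicator {ω | X (k + 1) ω = X k ω + 1} (fun _ => (1 : ℝ)) with hR
  set U : Ω → ℝ := (positiveUntil X k).indicator fun ω =>
    avoidProb (η ω) 0 n (X k ω + 1) (leftSites X k ω) with hU
  set V : Ω → ℝ := (positiveUntil X k).indicator fun ω =>
    if 0 < X k ω - 1 then avoidProb (η ω) 0 n (X k ω - 1) (insert (X k ω) (leftSites X k ω))
    else 0 with hV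
  have hUmeas : Measurable[pastSA η X k] U :=
    (measurable_avoidProb_right hηG 0 n (hXG k le_rfl)
      (measurableSet_mem_leftSites hXG)).indicator (measurableSet_positiveUntil hXG)
  have hVmeas : Measurable[pastSA η X k] V :=
    (measurable_avoidProb_left hηG 0 n (hXG k le_rfl)
      (measurableSet_mem_leftSites hXG)).indicator (measurableSet_positiveUntil hXG)
  have hU01 : ∀ ω, U ω ∈ Set.Icc (0 : ℝ) 1 := fun ω => by
    simp only [hU, Set.indicator]
    split_ifs
    · exact ⟨avoidProb_nonneg _ _ _ _ _, avoidProb_le_one _ _ _ _ _⟩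
    · simp
  have hV01 : ∀ ω, V ω ∈ Set.Icc (0 : ℝ) 1 := fun ω => by
    simp only [hV, Set.indicator]
    split_ifs
    · exact ⟨avoidProb_nonneg _ _ _ _ _, avoidProb_le_one _ _ _ _ _⟩
    · simp
    · simp
  have hRmeas : Measurable R := measurable_const.indicator
    (measurableSet_eq_fun (h.meas (k + 1)) ((h.meas k).add_const 1))
  have hR01 : ∀ ω, R ω = 0 ∨ R ω = 1 := fun ω => Set.indicator_eq_zero_or_self _ _ ω
  have hRint : Integrable R P := integrable_of_measurable_of_mem_Icc (a := 0) (b := 1) hRmeas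
    fun ω => by rcases hR01 ω with h | h <;> simp [h]
  have hDmeas : Measurable[pastSA η X k] (U - V) := hUmeas.sub hVmeas
  have hVint : Integrable V P :=
    integrable_of_measurable_of_mem_Icc (hVmeas.mono hGle le_rfl) hV01
  have hDRint : Integrable ((U - V) * R) P := integrable_of_measurable_of_mem_Icc
    (a := -1) (b := 1) ((hDmeas.mono hGle le_rfl).mul hRmeas) fun ω => by
      have hu := hU01 ω
      have hv := hV01 ω
      simp only [Set.mem_Icc, Pi.mul_apply, Pi.sub_apply] at hu hv ⊢
      rcases hR01 ω with h | h <;> rw [h] <;> constructor <;> linarith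
  have hstep : survival η X n (k + 1) =ᵐ[P] (U - V) * R + V := by
    filter_upwards [h.steps k] with ω hω
    have hmem := mem_positiveUntil_succ X k ω
    simp only [Pi.add_apply, Pi.mul_apply, Pi.sub_apply, survival, hU, hV, hR]
    by_cases hpos : ω ∈ positiveUntil X k
    · have hX1 : 1 ≤ X k ω := hpos k le_rfl
      rw [Set.indicator_of_mem hpos, Set.indicator_of_mem hpos]
      rcases (abs_eq zero_le_one).1 hω with h1 | h1
      · have h2 : X (k + 1) ω = X k ω + 1 := by omega
        rw [Set.indicator_of_mem (hmem.2 ⟨hpos, by omega⟩), leftSites_succ_of_right h2, h2,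
          Set.indicator_of_mem (show ω ∈ {ω | X (k + 1) ω = X k ω + 1} from h2)]
        ring
      · have h2 : X (k + 1) ω = X k ω - 1 := by omega
        rw [Set.indicator_of_notMem (s := {ω | X (k + 1) ω = X k ω + 1})
          (show ¬ X (k + 1) ω = X k ω + 1 by omega), mul_zero, zero_add]
        split_ifs with h3
        · rw [Set.indicator_of_mem (hmem.2 ⟨hpos, by omega⟩), leftSites_succ_of_left h2, h2]
        · rw [Set.indicator_of_notMem fun hh => h3 (by have := (hmem.1 hh).2; omega)]
    · rw [Set.indicator_of_notMem hpos, Set.indicator_of_notMem hpos,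
        Set.indicator_of_notMem fun hh => hpos (hmem.1 hh).1]
      ring
  have hmul := condExp_mul_of_stronglyMeasurable_left (μ := P) (m := pastSA η X k)
    hDmeas.stronglyMeasurable hDRint hRint
  have hVc : P[V | pastSA η X k] = V :=
    condExp_of_stronglyMeasurable hGle hVmeas.stronglyMeasurable hVint
  filter_upwards [condExp_congr_ae (m := pastSA η X k) hstep,
    condExp_add hDRint hVint (pastSA η X k), hmul, h.cond k,
    h.envRange] with ω h1 h2 h3 h4 h5
  rw [h1, h2, Pi.add_apply, h3, hVc, Pi.mul_apply, h4]
  have hq : η ω (X k ω) * Set.indicator (freshEvent X k) (fun _ => (1 : ℝ)) ω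
      + (1 / 2) * Set.indicator (freshEvent X k)ᶜ (fun _ => (1 : ℝ)) ω
      = rightProb (η ω) (X k ω) (leftSites X k ω) := by
    have hr := h5 (X k ω)
    unfold rightProb
    by_cases hf : ω ∈ freshEvent X k
    · have hf' := (mem_freshEvent_iff X k ω).1 hf
      simp [hf, hf', min_eq_left hr.2.le]
      simpa using hr.1
    · have hf' : X k ω ∈ leftSites X k ω := by
        simpa [mem_freshEvent_iff] using hf
      simp [hf, hf']
  rw [hq]
  simp only [survival, hU, hV, Pi.sub_apply, Set.indicator, avoidProb]
  by_cases hpos : ω ∈ positiveUntil X k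
  · simp only [hpos, if_true]
    ring
  · simp [hpos]

lemma IsCookieRWRE.condExp_survival_env (h : IsCookieRWRE P η X) (n k : ℕ) :
    P[survival η X n k | MeasurableSpace.comap η inferInstance]
      =ᵐ[P] P[survival η X (n + k) 0 | MeasurableSpace.comap η inferInstance] := by
  induction k generalizing n with
  | zero => rfl
  | succ k ih =>
    have h1 := condExp_condExp_of_le (μ := P) (f := survival η X n (k + 1))
      (le_sup_left : MeasurableSpace.comap η inferInstance ≤ _ ⊔ natSA X k) (h.pastSA_le k)
    have h2 := condExp_congr_ae (m := MeasurableSpace.comap η inferInstance)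
      (h.condExp_survival_past n k)
    have h3 := ih (n + 1)
    rw [show n + (k + 1) = n + 1 + k by ring]
    exact h1.symm.trans (h2.trans h3)

/-- The quenched probability of never hitting `0`. -/
theorem IsCookieRWRE.condExp_hitTime_eq_top (h : IsCookieRWRE P η X)
    (hX0 : ∀ᵐ ω ∂P, X 0 ω = 1) :
    P[Set.indicator {ω | hitTime X 0 ω = ⊤} (fun _ => (1 : ℝ)) |
        MeasurableSpace.comap η inferInstance] =ᵐ[P] fun ω => escapeProb (η ω) := by
  have hηm : Measurable[MeasurableSpace.comap η inferInstance] η := comap_measurable η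
  have hesc : Measurable[MeasurableSpace.comap η inferInstance] fun ω => escapeProb (η ω) :=
    measurable_escapeProb.comp hηm
  have hescint : Integrable (fun ω => escapeProb (η ω)) P :=
    integrable_of_measurable_of_mem_Icc (measurable_escapeProb.comp h.envMeas)
      fun ω => ⟨escapeProb_nonneg _, escapeProb_le_one _⟩
  have hbound : ∀ n k, ∀ᵐ ω ∂P, ‖survival η X n k ω‖ ≤ (fun _ => (1 : ℝ)) ω := fun n k =>
    ae_of_all _ fun ω => by
      have := survival_mem_Icc η X n k ω
      rw [Real.norm_of_nonneg this.1]
      exact this.2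
  have hlim := tendsto_condExp_unique (μ := P) (m := MeasurableSpace.comap η inferInstance)
    (fun n => survival η X 0 n) (fun n => survival η X n 0)
    (Set.indicator {ω | hitTime X 0 ω = ⊤} (fun _ => (1 : ℝ))) (fun ω => escapeProb (η ω))
    (h.integrable_survival 0) (fun n => h.integrable_survival n 0) ?_ ?_
    (fun _ => 1) (integrable_const _) (fun _ => 1) (integrable_const _) (hbound 0)
    (fun n => hbound n 0) (fun n => by simpa using h.condExp_survival_env 0 n)
  · rwa [condExp_of_stronglyMeasurable h.envMeas.comap_le hesc.stronglyMeasurable hescint] at hlim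
  · filter_upwards [hX0, ae_all_iff.2 h.steps] with ω h0 hs
    have hiff := hitTime_zero_eq_top_iff h0 hs
    by_cases hp : ∀ n, 1 ≤ X n ω
    · have h1 : ∀ n, survival η X 0 n ω = 1 := fun n => by
        rw [survival_zero_left]
        exact Set.indicator_of_mem (show ω ∈ positiveUntil X n from fun j _ => hp j) _
      simp [h1, hiff.2 hp]
    · have h2 : ¬ hitTime X 0 ω = ⊤ := fun hh => hp (hiff.1 hh)
      push Not at hp
      obtain ⟨N, hN⟩ := hp
      refine tendsto_const_nhds.congr' ?_
      filter_upwards [eventually_ge_atTop N] with n hn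
      rw [survival_zero_left, Set.indicator_of_notMem, Set.indicator_of_notMem]
      · exact fun hh => absurd (hh N hn) (by omega)
      · exact h2
  · filter_upwards [hX0] with ω h0
    have h1 : ∀ n, survival η X n 0 ω = avoidProb (η ω) 0 n 1 ∅ := fun n => by
      have hl : leftSites X 0 ω = ∅ := by simp [leftSites]
      rw [survival, Set.indicator_of_mem, h0, hl]
      intro j hj
      rw [Nat.le_zero.1 hj, h0]
    simp only [h1]
    exact tendsto_avoidProb _

end Walk

/-- Dichotomy: in a stationary ergodic environment, either the walk started at `1` hits `0`
almost surely, or the quenched probability of never hitting `0` is a.s. positive. -/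
theorem stmt2 {Ω : Type*} [MeasurableSpace Ω] (P : Measure Ω) [IsProbabilityMeasure P]
    (η : Ω → ℤ → ℝ) (X : ℕ → Ω → ℤ) (h : IsCookieRWRE P η X)
    (hX0 : ∀ᵐ ω ∂P, X 0 ω = 1)
    (herg : Ergodic (fun ω : ℤ → ℝ => fun x => ω (x + 1)) (P.map η)) :
    P {ω | hitTime X 0 ω = ⊤} = 0 ∨
    ∀ᵐ ω ∂P, 0 < (P[Set.indicator {ω' | hitTime X 0 ω' = ⊤} (fun _ => (1 : ℝ)) |
        MeasurableSpace.comap η inferInstance]) ω := by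
  have hcond := h.condExp_hitTime_eq_top hX0
  have hmeas : MeasurableSet {e : ℤ → ℝ | escapeProb e = 0} :=
    measurable_escapeProb (measurableSet_singleton 0)
  have hinv : {e : ℤ → ℝ | escapeProb e = 0} ≤ᵐ[P.map η]
      (fun e : ℤ → ℝ => fun x => e (x + 1)) ⁻¹' {e | escapeProb e = 0} := by
    refine LE.le.eventuallyLE fun e he => ?_
    have h1 := escapeProb_shift_le e
    have h2 := escapeProb_nonneg fun y => e (y + 1)
    rw [Set.mem_ofPred_eq] at he
    exact le_antisymm (by linarith) h2
  have : IsProbabilityMeasure (P.map η) := Measure.isProbabilityMeasure_map h.envMeas.aemeasurable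
  rcases herg.ae_empty_or_univ_of_ae_le_preimage hmeas.nullMeasurableSet hinv with h0 | h1
  · right
    have hpos : ∀ᵐ e ∂P.map η, escapeProb e ≠ 0 := by
      filter_upwards [h0] with e he h
      exact (eq_iff_iff.1 he).1 h
    filter_upwards [hcond, ae_of_ae_map h.envMeas.aemeasurable hpos] with ω hω hne
    rw [hω]
    exact lt_of_le_of_ne (escapeProb_nonneg _) hne.symm
  · left
    have hzero : ∀ᵐ e ∂P.map η, escapeProb e = 0 := by
      filter_upwards [h1] with e he
      exact (eq_iff_iff.1 he).2 trivial
    have hz := ae_of_ae_map h.envMeas.aemeasurable hzero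
    have hms : MeasurableSet {ω | hitTime X 0 ω = ⊤} := by
      simp only [hitTime_eq_top_iff, Set.ofPred_forall]
      exact MeasurableSet.iInter fun n =>
        (measurableSet_eq_fun (h.meas n) measurable_const).compl
    have hint := integral_condExp (μ := P) h.envMeas.comap_le
      (f := Set.indicator {ω | hitTime X 0 ω = ⊤} (fun _ => (1 : ℝ)))
    rw [integral_congr_ae (hcond.trans hz), integral_zero, integral_indicator_const _ hms] at hint
    simpa [measureReal_def, ENNReal.toReal_eq_zero_iff] using hint.symm
end
end

section
/- Let ω : ℤ → ℝ be an environment with ω(x) ∈ [1/2,1) for all x, periodic with period N ≥ 1 (ω(x+N) = ω(x) for all x), and suppose (1/N)·Σ_{x=1}^{N} ω(x)/(1 − ω(x)) > 2. Let X be a random walk in the 'have your cookie and eat it' environment ω with X_0 = 1 almost surely. Then P(T_0 = ∞) > 0 and lim_{n→∞} X_n = +∞ almost surely; that is, the process is transient. -/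
open MeasureTheory Filter

noncomputable section

/-- The set of sites from which the walk has jumped leftward before time `n`. -/
def usedSites {Ω : Type*} (X : ℕ → Ω → ℤ) : ℕ → Ω → Finset ℤ
  | 0, _ => ∅
  | n + 1, ω => if X (n + 1) ω = X n ω - 1 then insert (X n ω) (usedSites X n ω)
      else usedSites X n ω

/-- The probability of jumping rightward from `x` when the cookies at the sites of `S`
are exhausted. -/
def stepProb (env : ℤ → ℝ) (x : ℤ) (S : Finset ℤ) : ℝ := if x ∈ S then 1 / 2 else env x

/-- The probability that the cookie walk at `x`, with the cookies at the sites of `S` exhausted,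
stays strictly to the right of `b` for `n` steps. -/
def stayProb (env : ℤ → ℝ) (b : ℤ) : ℕ → ℤ → Finset ℤ → ℝ
  | 0, x, _ => if b < x then 1 else 0
  | n + 1, x, S => if b < x then stepProb env x S * stayProb env b n (x + 1) S
      + (1 - stepProb env x S) * stayProb env b n (x - 1) (insert x S) else 0

/-- The probability that the walk started at `y` with all cookies present does not visit `y - 1`
within `n` steps. -/
def freshStayProb (env : ℤ → ℝ) (y : ℤ) (n : ℕ) : ℝ := stayProb env (y - 1) n y ∅

/-- The expected total drift of the cookies at `x`. -/
def totalDrift (env : ℤ → ℝ) (x : ℤ) : ℝ := (2 * env x - 1) / (1 - env x)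

section StayProb

variable {env : ℤ → ℝ}

lemma half_le_stepProb (henv : ∀ x, env x ∈ Set.Ico (1 / 2 : ℝ) 1) (x : ℤ) (S : Finset ℤ) :
    1 / 2 ≤ stepProb env x S := by
  unfold stepProb; split_ifs
  · exact le_rfl
  · exact (henv x).1

lemma stepProb_le_one (henv : ∀ x, env x ∈ Set.Ico (1 / 2 : ℝ) 1) (x : ℤ) (S : Finset ℤ) :
    stepProb env x S ≤ 1 := by
  unfold stepProb; split_ifs
  · norm_num
  · exact (henv x).2.le

lemma stayProb_mem_Icc (henv : ∀ x, env x ∈ Set.Ico (1 / 2 : ℝ) 1) (b : ℤ) (n : ℕ) :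
    ∀ x S, stayProb env b n x S ∈ Set.Icc (0 : ℝ) 1 := by
  induction n with
  | zero => intro x S; unfold stayProb; split_ifs <;> simp
  | succ n ih =>
    intro x S
    unfold stayProb
    split_ifs
    · have h1 := half_le_stepProb henv x S
      have h2 := stepProb_le_one henv x S
      obtain ⟨h3, h4⟩ := ih (x + 1) S
      obtain ⟨h5, h6⟩ := ih (x - 1) (insert x S)
      constructor <;> nlinarith
    · simp

lemma stayProb_succ (b : ℤ) (n : ℕ) {x : ℤ} (hx : b < x) (S : Finset ℤ) :
    stayProb env b (n + 1) x S = stepProb env x S * stayProb env b n (x + 1) S +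
      (1 - stepProb env x S) * stayProb env b n (x - 1) (insert x S) := by
  rw [stayProb, if_pos hx]

lemma stayProb_of_le (b : ℤ) (n : ℕ) {x : ℤ} (hx : x ≤ b) (S : Finset ℤ) :
    stayProb env b n x S = 0 := by
  cases n <;> simp [stayProb, hx]

lemma stayProb_succ_le (henv : ∀ x, env x ∈ Set.Ico (1 / 2 : ℝ) 1) (b : ℤ) (n : ℕ) :
    ∀ x S, stayProb env b (n + 1) x S ≤ stayProb env b n x S := by
  induction n with
  | zero =>
    intro x S
    by_cases hx : b < x
    · simpa [stayProb, hx] using (stayProb_mem_Icc henv b 1 x S).2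
    · simp [stayProb, hx]
  | succ n ih =>
    intro x S
    by_cases hb : b < x
    · rw [stayProb_succ b (n + 1) hb, stayProb_succ b n hb]
      have h1 := half_le_stepProb henv x S
      have h2 := stepProb_le_one henv x S
      exact add_le_add (mul_le_mul_of_nonneg_left (ih (x + 1) S) (by linarith))
        (mul_le_mul_of_nonneg_left (ih (x - 1) (insert x S)) (by linarith))
    · rw [stayProb_of_le b _ (by omega), stayProb_of_le b _ (by omega)]

lemma stayProb_mono_base (henv : ∀ x, env x ∈ Set.Ico (1 / 2 : ℝ) 1) {a b : ℤ} (hab : a ≤ b)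
    (n : ℕ) : ∀ x S, stayProb env b n x S ≤ stayProb env a n x S := by
  induction n with
  | zero => intro x S; unfold stayProb; split_ifs <;> first | omega | norm_num
  | succ n ih =>
    intro x S
    by_cases hb : b < x
    · rw [stayProb_succ a n (by omega), stayProb_succ b n hb]
      have h1 := half_le_stepProb henv x S
      have h2 := stepProb_le_one henv x S
      exact add_le_add (mul_le_mul_of_nonneg_left (ih (x + 1) S) (by linarith))
        (mul_le_mul_of_nonneg_left (ih (x - 1) (insert x S)) (by linarith))
    · rw [stayProb_of_le b (n + 1) (by omega)]
      exact (stayProb_mem_Icc henv a (n + 1) x S).1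

lemma stayProb_translate {c : ℤ} (hc : ∀ z, env (z + c) = env z) (b : ℤ) (n : ℕ) :
    ∀ x S S', (∀ z, b < z → (z ∈ S ↔ z + c ∈ S')) →
      stayProb env b n x S = stayProb env (b + c) n (x + c) S' := by
  induction n with
  | zero => intro x S S' _; simp [stayProb]
  | succ n ih =>
    intro x S S' h
    by_cases hb : b < x
    · have hp : stepProb env x S = stepProb env (x + c) S' := by
        simp [stepProb, h x hb, hc]
      have e1 := ih (x + 1) S S' h
      have e2 := ih (x - 1) (insert x S) (insert (x + c) S') fun z hz => by simp [h z hz]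
      rw [show x + 1 + c = x + c + 1 by ring] at e1
      rw [show x - 1 + c = x + c - 1 by ring] at e2
      simp [stayProb, hb, hp, e1, e2]
    · simp [stayProb, hb]

lemma freshStayProb_translate {c : ℤ} (hc : ∀ z, env (z + c) = env z) (y : ℤ) (n : ℕ) :
    freshStayProb env (y + c) n = freshStayProb env y n := by
  have := stayProb_translate hc (y - 1) n y ∅ ∅ (by simp)
  rw [show y - 1 + c = y + c - 1 by ring] at this
  exact this.symm

lemma stayProb_eq_freshStayProb (y : ℤ) (n : ℕ) {S : Finset ℤ} (hS : ∀ z ∈ S, z < y) :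
    stayProb env (y - 1) n y S = freshStayProb env y n := by
  have := stayProb_translate (env := env) (c := 0) (by simp) (y - 1) n y S ∅ fun z hz => by
    simp only [Finset.notMem_empty, iff_false]
    intro h
    have := hS z h
    omega
  simpa [freshStayProb] using this

lemma freshStayProb_antitone (henv : ∀ x, env x ∈ Set.Ico (1 / 2 : ℝ) 1) (y : ℤ) :
    Antitone (freshStayProb env y) :=
  antitone_nat_of_succ_le fun n => stayProb_succ_le henv (y - 1) n y ∅

lemma half_freshStayProb_le (henv : ∀ x, env x ∈ Set.Ico (1 / 2 : ℝ) 1) (y : ℤ) (n : ℕ) :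
    freshStayProb env (y + 1) n / 2 ≤ freshStayProb env y (n + 1) := by
  have h1 := half_le_stepProb henv y ∅
  have h2 := stepProb_le_one henv y ∅
  have h3 := stayProb_mono_base henv (show y - 1 ≤ y by omega) n (y + 1) ∅
  have h4 := (stayProb_mem_Icc henv (y - 1) n (y - 1) (insert y ∅)).1
  have h5 := (stayProb_mem_Icc henv y n (y + 1) ∅).1
  simp only [freshStayProb, stayProb, sub_lt_self_iff, zero_lt_one, if_true, add_sub_cancel_right]
  nlinarith

lemma env_add_mul {N : ℕ} (hper : ∀ x : ℤ, env (x + N) = env x) (t z : ℤ) :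
    env (z + t * N) = env z := by
  have hp : Function.Periodic env (N : ℤ) := hper
  simpa using hp.int_mul t z

/-- Every site is a translate by a period of one of the sites `0, …, N - 1`. -/
lemma exists_residue {N : ℕ} (hN : 1 ≤ N) (y : ℤ) :
    ∃ r < N, ∃ t : ℤ, y = (r : ℤ) + t * N := by
  have hN0 : (0 : ℤ) < N := by exact_mod_cast hN
  obtain ⟨r, hr⟩ := Int.eq_ofNat_of_zero_le (Int.emod_nonneg y hN0.ne')
  have hrN := Int.emod_lt_of_pos y hN0
  have hdiv := Int.emod_add_mul_ediv y N
  exact ⟨r, by omega, y / N, by rw [hr] at hdiv; linarith⟩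

/-- If the walk escapes with positive probability from some site, then it does so from
every site. -/
lemma exists_pos_le_freshStayProb (henv : ∀ x, env x ∈ Set.Ico (1 / 2 : ℝ) 1) {N : ℕ} (hN : 1 ≤ N)
    (hper : ∀ x : ℤ, env (x + N) = env x) {a : ℤ} {c : ℝ} (hc : 0 < c)
    (ha : ∀ n, c ≤ freshStayProb env a n) :
    ∃ c' > 0, ∀ y n, c' ≤ freshStayProb env y n := by
  have key : ∀ j : ℕ, ∀ y n, (∀ n, c ≤ freshStayProb env (y + j) n) →
      c / 2 ^ j ≤ freshStayProb env y n := by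
    intro j
    induction j with
    | zero => intro y n h; simpa using h n
    | succ j ih =>
      intro y n h
      have h1 := ih (y + 1) n fun n => by
        convert h n using 2; push_cast; ring
      have h2 := half_freshStayProb_le henv y n
      have h3 := freshStayProb_antitone henv y (Nat.le_succ n)
      calc c / 2 ^ (j + 1) = c / 2 ^ j / 2 := by rw [pow_succ]; field_simp
        _ ≤ _ := by linarith
  refine ⟨c / 2 ^ N, by positivity, fun y n => ?_⟩
  obtain ⟨j, hj, t, ht⟩ := exists_residue hN (a - y)
  have h := key j y n fun n => by
    rw [show y + (j : ℤ) = a + (-t) * N by linarith,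
      freshStayProb_translate (env_add_mul hper _)]
    exact ha n
  refine le_trans ?_ h
  have := hj.le
  gcongr
  norm_num

lemma totalDrift_nonneg (henv : ∀ x, env x ∈ Set.Ico (1 / 2 : ℝ) 1) (x : ℤ) :
    0 ≤ totalDrift env x := by
  obtain ⟨h1, h2⟩ := henv x
  exact div_nonneg (by linarith) (by linarith)

lemma totalDrift_eq (henv : ∀ x, env x ∈ Set.Ico (1 / 2 : ℝ) 1) (x : ℤ) :
    totalDrift env x = env x / (1 - env x) - 1 := by
  have := (henv x).2
  have : 1 - env x ≠ 0 := by linarith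
  unfold totalDrift
  field_simp
  ring

lemma totalDrift_translate {c : ℤ} (hc : ∀ z, env (z + c) = env z) (x : ℤ) :
    totalDrift env (x + c) = totalDrift env x := by simp [totalDrift, hc]

lemma sum_totalDrift_Icc (henv : ∀ x, env x ∈ Set.Ico (1 / 2 : ℝ) 1) (N : ℕ) :
    ∑ x ∈ Finset.Icc (1 : ℤ) N, totalDrift env x =
      ∑ x ∈ Finset.Icc (1 : ℤ) N, env x / (1 - env x) - N := by
  simp [totalDrift_eq henv]

lemma exists_totalDrift_le (henv : ∀ x, env x ∈ Set.Ico (1 / 2 : ℝ) 1) {N : ℕ} (hN : 1 ≤ N)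
    (hper : ∀ x : ℤ, env (x + N) = env x) : ∃ D, ∀ x, totalDrift env x ≤ D := by
  refine ⟨∑ r ∈ Finset.range N, totalDrift env r, fun x => ?_⟩
  obtain ⟨r, hr, t, rfl⟩ := exists_residue hN x
  rw [totalDrift_translate (env_add_mul hper t)]
  exact Finset.single_le_sum (f := fun r : ℕ => totalDrift env r)
    (fun i _ => totalDrift_nonneg henv _) (Finset.mem_range.2 hr)

/-- If the walk escapes from no site, then it returns within a bounded time from every site
with probability close to `1`. -/
lemma exists_freshStayProb_le (henv : ∀ x, env x ∈ Set.Ico (1 / 2 : ℝ) 1) {N : ℕ} (hN : 1 ≤ N)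
    (hper : ∀ x : ℤ, env (x + N) = env x) {ε : ℝ}
    (h : ∀ a, ∃ n, freshStayProb env a n ≤ ε) : ∃ J, ∀ y, freshStayProb env y J ≤ ε := by
  choose n hn using h
  refine ⟨(Finset.range N).sup fun r => n r, fun y => ?_⟩
  obtain ⟨r, hr, t, rfl⟩ := exists_residue hN y
  rw [freshStayProb_translate (env_add_mul hper t)]
  exact (freshStayProb_antitone henv r
    (Finset.le_sup (f := fun r : ℕ => n r) (Finset.mem_range.2 hr))).trans (hn r)

lemma le_sum_totalDrift (henv : ∀ x, env x ∈ Set.Ico (1 / 2 : ℝ) 1) {N : ℕ} (hN : 1 ≤ N)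
    (hper : ∀ x : ℤ, env (x + N) = env x) {δ : ℝ} (hδ : 0 ≤ δ)
    (hsum : δ * N ≤ ∑ x ∈ Finset.Icc (1 : ℤ) N, totalDrift env x) (m : ℕ) :
    δ * (m - N) ≤ ∑ x ∈ Finset.Icc (1 : ℤ) m, totalDrift env x := by
  induction m using Nat.strong_induction_on with
  | _ m ih =>
    by_cases hm : m < N
    · refine le_trans ?_ (Finset.sum_nonneg fun x _ => totalDrift_nonneg henv x)
      have : (m : ℝ) < N := by exact_mod_cast hm
      nlinarith
    · obtain ⟨l, rfl⟩ := Nat.exists_eq_add_of_le (not_lt.1 hm)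
      have h1 := ih l (by omega)
      have h2 : Finset.Icc (1 : ℤ) ((N + l : ℕ) : ℤ) =
          Finset.Icc (1 : ℤ) N ∪ (Finset.Icc (1 : ℤ) l).image (· + (N : ℤ)) := by
        ext z
        simp only [Finset.mem_union, Finset.mem_image, Finset.mem_Icc]
        constructor
        · intro h
          by_cases hz : z ≤ N
          · exact Or.inl ⟨h.1, hz⟩
          · exact Or.inr ⟨z - N, by push_cast at h; omega, by ring⟩
        · rintro (h | ⟨w, h, rfl⟩) <;> push_cast <;> omega
      rw [h2, Finset.sum_union, Finset.sum_image (fun _ _ _ _ h => add_right_cancel h)]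
      · simp only [totalDrift_translate hper]
        push_cast
        linarith
      · rw [Finset.disjoint_left]
        simp only [Finset.mem_image, Finset.mem_Icc]
        rintro z h ⟨w, h', rfl⟩
        omega

end StayProb

section Walk

variable {Ω : Type*} {X : ℕ → Ω → ℤ}

lemma mem_usedSites {n : ℕ} {ω : Ω} {y : ℤ} :
    y ∈ usedSites X n ω ↔ ∃ m < n, X m ω = y ∧ X (m + 1) ω = X m ω - 1 := by
  induction n with
  | zero => simp [usedSites]
  | succ n ih =>
    simp only [usedSites, Nat.lt_succ_iff_lt_or_eq, or_and_right, exists_or, ← ih, exists_eq_left]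
    split_ifs with h
    · rw [Finset.mem_insert]; tauto
    · tauto

lemma mem_freshEvent {n : ℕ} {ω : Ω} : ω ∈ freshEvent X n ↔ X n ω ∉ usedSites X n ω := by
  simp only [freshEvent, Set.mem_ofPred_eq, mem_usedSites]
  push Not
  rfl

lemma usedSites_congr {n : ℕ} {ω ω' : Ω} (h : ∀ m ≤ n, X m ω = X m ω') :
    usedSites X n ω = usedSites X n ω' := by
  ext y
  simp only [mem_usedSites]
  refine exists_congr fun m => and_congr_right fun hm => ?_
  rw [h m hm.le, h (m + 1) hm]

lemma card_usedSites_le (n : ℕ) (ω : Ω) : (usedSites X n ω).card ≤ n := by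
  induction n with
  | zero => simp [usedSites]
  | succ n ih =>
    unfold usedSites
    split_ifs
    · exact (Finset.card_insert_le _ _).trans (by omega)
    · omega

lemma measurable_natSA {m n : ℕ} (h : m ≤ n) : Measurable[natSA X n] (X m) := by
  rw [measurable_iff_comap_le]
  exact le_iSup₂_of_le (f := fun m (_ : m ∈ Finset.range (n + 1)) =>
    MeasurableSpace.comap (X m) ⊤) m (by simp; omega) le_rfl

lemma natSA_mono : Monotone (natSA X) := fun _ _ hmn =>
  iSup₂_le fun i hi => le_iSup₂_of_le (f := fun m (_ : m ∈ Finset.range _) =>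
    MeasurableSpace.comap (X m) ⊤) i (by simp at hi ⊢; omega) le_rfl

lemma natSA_le [m0 : MeasurableSpace Ω] (hX : ∀ n, Measurable (X n)) (n : ℕ) : natSA X n ≤ m0 :=
  iSup₂_le fun i _ => (hX i).comap_le

/-- The natural filtration of the process `X`. -/
def natFiltration [m0 : MeasurableSpace Ω] (hX : ∀ n, Measurable (X n)) : Filtration ℕ m0 where
  seq := natSA X
  mono' := natSA_mono
  le' := natSA_le hX

/-- A function of the first `n + 1` positions is measurable at time `n`. -/
lemma measurable_of_history {β : Type*} [MeasurableSpace β] [Nonempty β] {n : ℕ} {f : Ω → β}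
    (hf : ∀ ω ω', (∀ m ≤ n, X m ω = X m ω') → f ω = f ω') : Measurable[natSA X n] f := by
  let H : Ω → (Fin (n + 1) → ℤ) := fun ω m => X m ω
  have hfac : f.FactorsThrough H := fun ω ω' h => hf ω ω' fun m hm =>
    congrFun h ⟨m, Nat.lt_succ_of_le hm⟩
  obtain ⟨g, rfl⟩ := (Function.factorsThrough_iff f).1 hfac
  have hH : Measurable[natSA X n] H :=
    @measurable_pi_lambda _ _ _ (natSA X n) _ _ fun m => measurable_natSA (Nat.lt_succ_iff.1 m.2)
  have hg : Measurable g := measurable_of_countable g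
  exact hg.comp hH

lemma measurableSet_of_history {n : ℕ} {s : Set Ω}
    (hs : ∀ ω ω', (∀ m ≤ n, X m ω = X m ω') → (ω ∈ s ↔ ω' ∈ s)) : MeasurableSet[natSA X n] s := by
  have : Measurable[natSA X n] (fun ω => ω ∈ s) :=
    measurable_of_history fun ω ω' h => propext (hs ω ω' h)
  exact @measurableSet_setOfPred _ (natSA X n) _ |>.2 this

variable {env : ℤ → ℝ}

/-- The indicator of a rightward jump at time `n`. -/
def rightJump (X : ℕ → Ω → ℤ) (n : ℕ) : Ω → ℝ :=
  Set.indicator {ω | X (n + 1) ω = X n ω + 1} (fun _ => (1 : ℝ))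

lemma rightJump_abs_le (n : ℕ) (ω : Ω) : |rightJump X n ω| ≤ 1 := by
  unfold rightJump Set.indicator; split_ifs <;> simp

/-- The conditional probability of a rightward jump at time `n`. -/
def jumpProb (env : ℤ → ℝ) (X : ℕ → Ω → ℤ) (n : ℕ) (ω : Ω) : ℝ :=
  stepProb env (X n ω) (usedSites X n ω)

lemma measurable_jumpProb (n : ℕ) : Measurable[natSA X n] (jumpProb env X n) :=
  measurable_of_history fun ω ω' h => by simp only [jumpProb, h n le_rfl, usedSites_congr h]

lemma jumpProb_abs_le (henv : ∀ x, env x ∈ Set.Ico (1 / 2 : ℝ) 1) (n : ℕ) (ω : Ω) :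
    |jumpProb env X n ω| ≤ 1 := by
  have h1 := half_le_stepProb henv (X n ω) (usedSites X n ω)
  have h2 := stepProb_le_one henv (X n ω) (usedSites X n ω)
  rw [abs_le]; unfold jumpProb; constructor <;> linarith

/-- The event that the walk stays strictly to the right of `b` from time `k` to time `k + n`. -/
def stayEvent (X : ℕ → Ω → ℤ) (b : ℤ) (k n : ℕ) : Set Ω := {ω | ∀ i ≤ n, b < X (k + i) ω}

lemma measurableSet_stayEvent (b : ℤ) (k n : ℕ) :
    MeasurableSet[natSA X (k + n)] (stayEvent X b k n) :=
  measurableSet_of_history fun ω ω' h => by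
    simp only [stayEvent, Set.mem_ofPred_eq]
    exact forall₂_congr fun i hi => by rw [h (k + i) (by omega)]

/-- The event that the walk first visits `y` at time `k`, coming from the left. -/
def firstVisit (X : ℕ → Ω → ℤ) (y : ℤ) (k : ℕ) : Set Ω := {ω | X k ω = y ∧ ∀ m < k, X m ω < y}

lemma measurableSet_firstVisit (y : ℤ) (k : ℕ) : MeasurableSet[natSA X k] (firstVisit X y k) :=
  measurableSet_of_history fun ω ω' h => by
    simp only [firstVisit, Set.mem_ofPred_eq, h k le_rfl]
    exact and_congr_right fun _ => forall₂_congr fun i hi => by rw [h i hi.le]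

/-- The running maximum of the walk. -/
def runMax (X : ℕ → Ω → ℤ) : ℕ → Ω → ℤ
  | 0, ω => X 0 ω
  | n + 1, ω => max (runMax X n ω) (X (n + 1) ω)

lemma le_runMax_iff {n : ℕ} {ω : Ω} {y : ℤ} : y ≤ runMax X n ω ↔ ∃ k ≤ n, y ≤ X k ω := by
  induction n with
  | zero => simp [runMax]
  | succ n ih =>
    simp only [runMax, le_max_iff, ih, Nat.le_succ_iff, or_and_right, exists_or, exists_eq_left]

lemma runMax_congr {n : ℕ} {ω ω' : Ω} (h : ∀ m ≤ n, X m ω = X m ω') :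
    runMax X n ω = runMax X n ω' := by
  refine eq_of_forall_le_iff fun y => ?_
  simp only [le_runMax_iff]
  exact exists_congr fun k => and_congr_right fun hk => by rw [h k hk]

lemma le_add_of_path {ω : Ω} (h : ∀ n, |X (n + 1) ω - X n ω| = 1) (n j : ℕ) :
    X (n + j) ω ≤ X n ω + j := by
  induction j with
  | zero => simp
  | succ j ih =>
    have := (abs_le.1 (h (n + j)).le).2
    rw [← add_assoc]; push_cast; linarith

lemma runMax_le_of_path {ω : Ω} (h0 : X 0 ω = 1) (h : ∀ n, |X (n + 1) ω - X n ω| = 1) (n : ℕ) :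
    runMax X n ω ≤ n + 1 := by
  obtain ⟨k, hk, h1⟩ := le_runMax_iff.1 (le_refl (runMax X n ω))
  have := le_add_of_path h 0 k
  rw [zero_add, h0] at this
  have : (k : ℤ) ≤ n := by exact_mod_cast hk
  linarith

lemma one_le_runMax {ω : Ω} (h0 : X 0 ω = 1) (n : ℕ) : 1 ≤ runMax X n ω :=
  le_runMax_iff.2 ⟨0, Nat.zero_le _, h0.ge⟩

lemma exists_firstVisit {ω : Ω} (h0 : X 0 ω = 1) (h : ∀ n, |X (n + 1) ω - X n ω| = 1) {y : ℤ}
    (hy : 1 ≤ y) {n : ℕ} (hn : y ≤ X n ω) : ∃ k ≤ n, ω ∈ firstVisit X y k := by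
  classical
  have hex : ∃ k, y ≤ X k ω := ⟨n, hn⟩
  have hmin : ∀ m < Nat.find hex, X m ω < y := fun m hm => not_le.1 (Nat.find_min hex hm)
  refine ⟨Nat.find hex, Nat.find_min' hex hn, ?_, hmin⟩
  have hspec := Nat.find_spec hex
  rcases hk : Nat.find hex with _ | k
  · rw [hk] at hspec; omega
  · rw [hk] at hspec hmin
    have h1 := hmin k k.lt_succ_self
    have h2 := (abs_le.1 (h k).le).2
    omega

lemma mem_usedSites_of_return {ω : Ω} (h : ∀ n, |X (n + 1) ω - X n ω| = 1) {y : ℤ} {k J : ℕ}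
    (hk : X k ω = y) (hr : ω ∉ stayEvent X (y - 1) k J) : y ∈ usedSites X (k + J) ω := by
  classical
  have hex : ∃ i, i ≤ J ∧ X (k + i) ω < y := by
    simp only [stayEvent, Set.mem_ofPred_eq] at hr
    push Not at hr
    obtain ⟨i, hi, hi'⟩ := hr
    exact ⟨i, hi, by omega⟩
  obtain ⟨hJ, hlt⟩ := Nat.find_spec hex
  rcases hi : Nat.find hex with _ | i
  · rw [hi] at hlt
    rw [add_zero, hk] at hlt
    omega
  · rw [hi] at hJ hlt
    have h1 : ¬ X (k + i) ω < y := fun hlt' => by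
      have := Nat.find_min' hex ⟨by omega, hlt'⟩
      omega
    have h2 := (abs_le.1 (h (k + i)).le).1
    rw [← add_assoc] at hlt
    exact mem_usedSites.2 ⟨k + i, by omega, by omega, by omega⟩

lemma hitTime_eq_top {x : ℤ} {ω : Ω} (h : ∀ n, X n ω ≠ x) : hitTime X x ω = ⊤ := by
  simp [hitTime, h]

variable [MeasurableSpace Ω] {P : Measure Ω}

lemma measurable_rightJump (hX : IsCookieRW P env X) (n : ℕ) : Measurable (rightJump X n) :=
  measurable_const.indicator (measurableSet_eq_fun (hX.meas _) ((hX.meas _).add_const 1))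

lemma integrable_jumpProb_mul (hX : IsCookieRW P env X) {n : ℕ} {a : Ω → ℝ}
    (ha : Integrable a P) : Integrable (fun ω => jumpProb env X n ω * a ω) P :=
  ha.bdd_mul ((measurable_jumpProb n).mono (natSA_le hX.meas n) le_rfl).aestronglyMeasurable
    (ae_of_all _ (jumpProb_abs_le hX.envRange n))

lemma ae_jump (hX : IsCookieRW P env X) (n : ℕ) : ∀ᵐ ω ∂P,
    (rightJump X n ω = 1 ∧ X (n + 1) ω = X n ω + 1 ∧ usedSites X (n + 1) ω = usedSites X n ω) ∨
    (rightJump X n ω = 0 ∧ X (n + 1) ω = X n ω - 1 ∧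
      usedSites X (n + 1) ω = insert (X n ω) (usedSites X n ω)) := by
  filter_upwards [hX.steps n] with ω h
  rcases (abs_eq zero_le_one).1 h with h | h
  · have h' : X (n + 1) ω = X n ω + 1 := by omega
    exact Or.inl ⟨by simp [rightJump, h'], h', by rw [usedSites, if_neg (by omega)]⟩
  · have h' : X (n + 1) ω = X n ω - 1 := by omega
    refine Or.inr ⟨?_, h', by rw [usedSites, if_pos h']⟩
    rw [rightJump, Set.indicator_of_notMem]
    simp only [Set.mem_ofPred_eq]; omega

lemma integrable_rightJump_mul (hX : IsCookieRW P env X) {n : ℕ} {a : Ω → ℝ}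
    (ha : Integrable a P) : Integrable (fun ω => rightJump X n ω * a ω) P :=
  ha.bdd_mul (measurable_rightJump hX n).aestronglyMeasurable
    (ae_of_all _ (rightJump_abs_le n))

/-- Almost every trajectory starts at `1` and is a nearest neighbour path. -/
lemma ae_path (hX : IsCookieRW P env X) (hX0 : ∀ᵐ ω ∂P, X 0 ω = 1) :
    ∀ᵐ ω ∂P, X 0 ω = 1 ∧ ∀ n, |X (n + 1) ω - X n ω| = 1 := by
  filter_upwards [hX0, ae_all_iff.2 hX.steps] with ω h0 h using ⟨h0, h⟩

lemma measurableSet_le_runMax (hX : IsCookieRW P env X) (y : ℤ) (n : ℕ) :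
    MeasurableSet {ω | y ≤ runMax X n ω} :=
  natSA_le hX.meas n _ (measurableSet_of_history fun ω ω' h => by
    simp only [Set.mem_ofPred_eq, runMax_congr h])

lemma measurableSet_mem_usedSites (hX : IsCookieRW P env X) (y : ℤ) (n : ℕ) :
    MeasurableSet {ω | y ∈ usedSites X n ω} :=
  natSA_le hX.meas n _ (measurableSet_of_history fun ω ω' h => by
    simp only [Set.mem_ofPred_eq, usedSites_congr h])

variable [IsProbabilityMeasure P]

lemma integrable_of_natSA (hX : IsCookieRW P env X) {n : ℕ} {a : Ω → ℝ}
    (ha : Measurable[natSA X n] a) {C : ℝ} (hC : ∀ ω, |a ω| ≤ C) : Integrable a P :=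
  Integrable.of_bound (ha.mono (natSA_le hX.meas n) le_rfl).aestronglyMeasurable C
    (ae_of_all _ hC)

lemma integral_rightJump_mul (hX : IsCookieRW P env X) {n : ℕ} {a : Ω → ℝ}
    (ha : Measurable[natSA X n] a) {C : ℝ} (hC : ∀ ω, |a ω| ≤ C) :
    ∫ ω, rightJump X n ω * a ω ∂P = ∫ ω, jumpProb env X n ω * a ω ∂P := by
  have hle := natSA_le hX.meas n
  have hint := integrable_rightJump_mul hX (n := n) (integrable_of_natSA hX ha hC)
  have hr : Integrable (rightJump X n) P :=
    Integrable.of_bound (measurable_rightJump hX n).aestronglyMeasurable 1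
      (ae_of_all _ (rightJump_abs_le n))
  rw [← integral_condExp hle]
  refine integral_congr_ae ?_
  have h1 := condExp_mul_of_stronglyMeasurable_right (μ := P) (m := natSA X n)
    ha.stronglyMeasurable hint hr
  filter_upwards [h1, hX.cond n] with ω h1 h2
  refine h1.trans ?_
  rw [Pi.mul_apply, rightJump, h2]
  congr 1
  by_cases h : ω ∈ freshEvent X n
  · simp [h, jumpProb, stepProb, mem_freshEvent.1 h]
  · simp [h, jumpProb, stepProb, not_not.1 (mem_freshEvent.not.1 h)]

/-- Averaging over the jump at time `n`. -/
lemma integral_jump (hX : IsCookieRW P env X) {n : ℕ} {a b : Ω → ℝ}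
    (ha : Measurable[natSA X n] a) (hb : Measurable[natSA X n] b) {C : ℝ}
    (haC : ∀ ω, |a ω| ≤ C) (hbC : ∀ ω, |b ω| ≤ C) :
    ∫ ω, (rightJump X n ω * a ω + (1 - rightJump X n ω) * b ω) ∂P =
      ∫ ω, (jumpProb env X n ω * a ω + (1 - jumpProb env X n ω) * b ω) ∂P := by
  have ia := integrable_of_natSA hX ha haC
  have ib := integrable_of_natSA hX hb hbC
  simp only [sub_mul, one_mul]
  rw [integral_add, integral_add, integral_sub, integral_sub, integral_rightJump_mul hX ha haC,
    integral_rightJump_mul hX hb hbC]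
  all_goals
    first
    | exact ia | exact ib
    | exact integrable_rightJump_mul hX ‹_›
    | exact integrable_jumpProb_mul hX ‹_›
    | exact ib.sub (integrable_rightJump_mul hX ib)
    | exact ib.sub (integrable_jumpProb_mul hX ib)

lemma integral_mul_stayEvent (hX : IsCookieRW P env X) (b : ℤ) (n : ℕ) :
    ∀ (k : ℕ) {a : Ω → ℝ}, Measurable[natSA X k] a → (∀ ω, |a ω| ≤ 1) →
      ∫ ω, a ω * (stayEvent X b k n).indicator 1 ω ∂P =
        ∫ ω, a ω * stayProb env b n (X k ω) (usedSites X k ω) ∂P := by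
  induction n with
  | zero =>
    intro k a _ _
    congr 1 with ω
    simp [stayEvent, stayProb, Set.indicator]
  | succ n ih =>
    intro k a ha ha1
    let I : Ω → ℝ := fun ω => if b < X k ω then 1 else 0
    have hI : ∀ {β : Type} [MeasurableSpace β] [Nonempty β] (F : ℤ → Finset ℤ → β),
        Measurable[natSA X k] fun ω => F (X k ω) (usedSites X k ω) := fun F =>
      measurable_of_history fun ω ω' h => by rw [h k le_rfl, usedSites_congr h]
    have haI : Measurable[natSA X k] fun ω => a ω * I ω :=
      ha.mul (hI fun x _ => if b < x then 1 else 0)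
    have haI1 : ∀ ω, |a ω * I ω| ≤ 1 := fun ω => by
      rw [abs_mul]
      have : |I ω| ≤ 1 := by simp only [I]; split_ifs <;> simp
      exact mul_le_one₀ (ha1 ω) (abs_nonneg _) this
    have hb : ∀ (x : ℤ) (S : Finset ℤ) (ω : Ω), |a ω * I ω * stayProb env b n x S| ≤ 1 := by
      intro x S ω
      have := stayProb_mem_Icc hX.envRange b n x S
      rw [abs_mul]
      exact mul_le_one₀ (haI1 ω) (abs_nonneg _) (by rw [abs_of_nonneg this.1]; exact this.2)
    calc ∫ ω, a ω * (stayEvent X b k (n + 1)).indicator 1 ω ∂P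
        = ∫ ω, a ω * I ω * (stayEvent X b (k + 1) n).indicator 1 ω ∂P := by
          congr 1 with ω
          have : ω ∈ stayEvent X b k (n + 1) ↔ b < X k ω ∧ ω ∈ stayEvent X b (k + 1) n := by
            simp only [stayEvent, Set.mem_ofPred_eq]
            constructor
            · refine fun h => ⟨h 0 (by omega), fun i hi => ?_⟩
              rw [add_assoc, add_comm 1]; exact h (i + 1) (by omega)
            · rintro ⟨h0, h⟩ (_ | i) hi
              · exact h0
              · have := h i (by omega)
                rwa [add_assoc, add_comm 1] at this
          by_cases h1 : b < X k ω <;> by_cases h2 : ω ∈ stayEvent X b (k + 1) n <;>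
            simp [I, Set.indicator, this, h1, h2]
      _ = ∫ ω, a ω * I ω * stayProb env b n (X (k + 1) ω) (usedSites X (k + 1) ω) ∂P :=
          ih (k + 1) (haI.mono (natSA_mono k.le_succ) le_rfl) haI1
      _ = ∫ ω, (rightJump X k ω *
              (a ω * I ω * stayProb env b n (X k ω + 1) (usedSites X k ω)) +
            (1 - rightJump X k ω) * (a ω * I ω *
              stayProb env b n (X k ω - 1) (insert (X k ω) (usedSites X k ω)))) ∂P := by
          refine integral_congr_ae ?_
          filter_upwards [ae_jump hX k] with ω h
          rcases h with ⟨h1, h2, h3⟩ | ⟨h1, h2, h3⟩ <;> simp [h1, h2, h3]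
      _ = _ := by
          refine (integral_jump hX (haI.mul (hI fun x S => stayProb env b n (x + 1) S))
            (haI.mul (hI fun x S => stayProb env b n (x - 1) (insert x S)))
            (fun ω => hb _ _ ω) (fun ω => hb _ _ ω)).trans ?_
          congr 1 with ω
          simp only [Pi.mul_apply]
          by_cases h : b < X k ω
          · simp only [I, h, stayProb, if_true, jumpProb]; ring
          · simp [I, h, stayProb]

lemma measureReal_inter_stayEvent (hX : IsCookieRW P env X) (y : ℤ) (k n : ℕ) {s : Set Ω}
    (hs : MeasurableSet[natSA X k] s) (hsub : s ⊆ firstVisit X y k) :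
    P.real (s ∩ stayEvent X (y - 1) k n) = P.real s * freshStayProb env y n := by
  have hs' := natSA_le hX.meas k s hs
  have hm : MeasurableSet (stayEvent X (y - 1) k n) :=
    natSA_le hX.meas _ _ (measurableSet_stayEvent (y - 1) k n)
  have h := integral_mul_stayEvent hX (y - 1) n k (a := s.indicator 1)
    ((@measurable_const ℝ Ω _ (natSA X k) 1).indicator hs) (fun ω => by unfold Set.indicator; split_ifs <;> simp)
  have h1 : (fun ω => s.indicator (1 : Ω → ℝ) ω * (stayEvent X (y - 1) k n).indicator 1 ω) =
      (s ∩ stayEvent X (y - 1) k n).indicator 1 := by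
    rw [Set.inter_indicator_one]; rfl
  have h2 : (fun ω => s.indicator (1 : Ω → ℝ) ω *
      stayProb env (y - 1) n (X k ω) (usedSites X k ω)) =
      fun ω => s.indicator 1 ω * freshStayProb env y n := by
    ext ω
    by_cases hω : ω ∈ s
    · obtain ⟨h1, h2⟩ := hsub hω
      rw [h1, stayProb_eq_freshStayProb]
      intro z hz
      obtain ⟨m, hm, rfl, -⟩ := mem_usedSites.1 hz
      exact h2 m hm
    · simp [hω]
  rw [h1, h2, integral_indicator_one (hs'.inter hm), integral_mul_const,
    integral_indicator_one hs'] at h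
  exact h

lemma integrable_position (hX : IsCookieRW P env X) (hX0 : ∀ᵐ ω ∂P, X 0 ω = 1) (n : ℕ) :
    Integrable (fun ω => (X n ω : ℝ)) P := by
  refine Integrable.of_bound (measurable_from_top.comp (hX.meas n)).aestronglyMeasurable
    ((n : ℝ) + 1) ?_
  filter_upwards [ae_path hX hX0] with ω ⟨h0, h⟩
  rw [Real.norm_eq_abs]
  induction n with
  | zero => simp [h0]
  | succ n ih =>
    have h1 : |(X (n + 1) ω : ℝ) - X n ω| = 1 := by exact_mod_cast h n
    have h2 := abs_sub_abs_le_abs_sub (X (n + 1) ω : ℝ) (X n ω)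
    push_cast
    linarith

lemma submartingale_position (hX : IsCookieRW P env X) (hX0 : ∀ᵐ ω ∂P, X 0 ω = 1) :
    Submartingale (fun n ω => (X n ω : ℝ)) (natFiltration hX.meas) P := by
  have hint := integrable_position hX hX0
  refine submartingale_of_setIntegral_le_succ
    (fun n => (measurable_from_top.comp (measurable_natSA le_rfl)).stronglyMeasurable) hint
    fun n s hs => ?_
  have hs : MeasurableSet[natSA X n] s := hs
  have hs' := natSA_le hX.meas n s hs
  rw [← sub_nonneg, ← integral_sub (hint _).integrableOn (hint _).integrableOn,
    ← integral_indicator hs']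
  have hm : ∀ c : ℝ, Measurable[natSA X n] (s.indicator fun _ => c) := fun c =>
    (@measurable_const ℝ Ω _ (natSA X n) c).indicator hs
  have hb : ∀ c : ℝ, |c| ≤ 1 → ∀ ω, |s.indicator (fun _ => c) ω| ≤ 1 := fun c hc ω => by
    unfold Set.indicator; split_ifs <;> simp [hc]
  have h := integral_jump hX (hm 1) (hm (-1)) (hb 1 (by simp)) (hb (-1) (by simp))
  have h1 : ∫ ω, s.indicator (fun ω => (X (n + 1) ω : ℝ) - X n ω) ω ∂P =
      ∫ ω, (rightJump X n ω * s.indicator (fun _ => 1) ω +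
        (1 - rightJump X n ω) * s.indicator (fun _ => -1) ω) ∂P := by
    refine integral_congr_ae ?_
    filter_upwards [ae_jump hX n] with ω h
    by_cases hω : ω ∈ s <;> rcases h with ⟨h1, h2, -⟩ | ⟨h1, h2, -⟩ <;> simp [hω, h1, h2]
  rw [h1, h]
  refine integral_nonneg fun ω => ?_
  have := half_le_stepProb hX.envRange (X n ω) (usedSites X n ω)
  by_cases hω : ω ∈ s
  · simp only [hω, Set.indicator_of_mem, jumpProb, Pi.zero_apply]
    linarith
  · simp [hω]

/-- The walk is almost surely unbounded above. -/
lemma ae_unbounded (hX : IsCookieRW P env X) (hX0 : ∀ᵐ ω ∂P, X 0 ω = 1) :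
    ∀ᵐ ω ∂P, ∀ K : ℤ, ∃ n, K ≤ X n ω := by
  have hbdd : ∀ᵐ ω ∂P, ∀ n, |(X (n + 1) ω : ℝ) - X n ω| ≤ (1 : NNReal) := by
    filter_upwards [ae_path hX hX0] with ω ⟨_, h⟩ n
    have : |(X (n + 1) ω : ℝ) - X n ω| = 1 := by exact_mod_cast h n
    simp [this]
  filter_upwards [(submartingale_position hX hX0).bddAbove_iff_exists_tendsto hbdd,
    ae_path hX hX0] with ω hω ⟨_, hpath⟩
  by_contra! hK
  obtain ⟨K, hK⟩ := hK
  obtain ⟨c, hc⟩ := hω.1 ⟨(K : ℝ), by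
    rintro _ ⟨n, rfl⟩
    show (X n ω : ℝ) ≤ K
    exact_mod_cast (hK n).le⟩
  have h0 := (((tendsto_add_atTop_iff_nat 1).2 hc).sub hc).abs
  have h1 : ∀ n, |(X (n + 1) ω : ℝ) - X n ω| = 1 := fun n => by exact_mod_cast hpath n
  simp [h1] at h0

lemma integrable_sum_totalDrift (hX : IsCookieRW P env X) {D : ℝ} (hD : ∀ x, totalDrift env x ≤ D)
    (n : ℕ) : Integrable (fun ω => ∑ y ∈ usedSites X n ω, totalDrift env y) P := by
  have hD0 : 0 ≤ D := (totalDrift_nonneg hX.envRange 0).trans (hD 0)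
  refine integrable_of_natSA hX (n := n) (C := n * D)
    (measurable_of_history fun ω ω' h => by rw [usedSites_congr h]) fun ω => ?_
  rw [abs_of_nonneg (Finset.sum_nonneg fun y _ => totalDrift_nonneg hX.envRange y)]
  refine (Finset.sum_le_card_nsmul _ _ D fun y _ => hD y).trans ?_
  rw [nsmul_eq_mul]
  have : ((usedSites X n ω).card : ℝ) ≤ n := by exact_mod_cast card_usedSites_le n ω
  gcongr

/-- The walk compensated by the total drifts of its used sites is a martingale. -/
lemma integral_position (hX : IsCookieRW P env X) (hX0 : ∀ᵐ ω ∂P, X 0 ω = 1) {D : ℝ}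
    (hD : ∀ x, totalDrift env x ≤ D) (n : ℕ) :
    ∫ ω, (X n ω : ℝ) ∂P = 1 + ∫ ω, ∑ y ∈ usedSites X n ω, totalDrift env y ∂P := by
  have hint := integrable_position hX hX0
  have hint' := integrable_sum_totalDrift hX hD
  have hD0 : 0 ≤ D := (totalDrift_nonneg hX.envRange 0).trans (hD 0)
  induction n with
  | zero =>
    have : ∫ ω, (X 0 ω : ℝ) ∂P = ∫ _, (1 : ℝ) ∂P := by
      refine integral_congr_ae ?_
      filter_upwards [hX0] with ω h
      simp [h]
    simp [this, usedSites]
  | succ n ih =>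
    let b : Ω → ℝ := fun ω => -1 - if X n ω ∈ usedSites X n ω then 0 else totalDrift env (X n ω)
    have hb : Measurable[natSA X n] b := measurable_of_history fun ω ω' h => by
      simp only [b, h n le_rfl, usedSites_congr h]
    have hbD : ∀ ω, |b ω| ≤ 1 + D := fun ω => by
      have h1 := totalDrift_nonneg hX.envRange (X n ω)
      have h2 := hD (X n ω)
      rw [abs_le]
      simp only [b]
      split_ifs <;> constructor <;> linarith
    have h := integral_jump hX (@measurable_const ℝ Ω _ (natSA X n) 1) hb
      (fun ω => show |(1 : ℝ)| ≤ 1 + D by rw [abs_one]; linarith) hbD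
    have h0 : ∫ ω, (jumpProb env X n ω * 1 + (1 - jumpProb env X n ω) * b ω) ∂P = 0 := by
      have : ∀ ω, jumpProb env X n ω * 1 + (1 - jumpProb env X n ω) * b ω = 0 := fun ω => by
        simp only [jumpProb, stepProb, b, totalDrift]
        have : 1 - env (X n ω) ≠ 0 := by have := (hX.envRange (X n ω)).2; linarith
        split_ifs
        · ring
        · field_simp; ring
      simp only [this, integral_zero]
    have h1 : ∫ ω, (((X (n + 1) ω : ℝ) - X n ω) - (∑ y ∈ usedSites X (n + 1) ω, totalDrift env y -
        ∑ y ∈ usedSites X n ω, totalDrift env y)) ∂P = 0 := by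
      rw [← h0, ← h]
      refine integral_congr_ae ?_
      filter_upwards [ae_jump hX n] with ω h
      rcases h with ⟨h1, h2, h3⟩ | ⟨h1, h2, h3⟩
      · simp [h1, h2, h3]
      · by_cases hu : X n ω ∈ usedSites X n ω
        · simp [h1, h2, h3, b, hu]
        · simp [h1, h2, h3, b, hu, Finset.sum_insert hu]
    have i1 : Integrable (fun ω => (X (n + 1) ω : ℝ) - X n ω) P := (hint _).sub (hint _)
    have i2 : Integrable (fun ω => ∑ y ∈ usedSites X (n + 1) ω, totalDrift env y -
        ∑ y ∈ usedSites X n ω, totalDrift env y) P := (hint' _).sub (hint' _)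
    rw [integral_sub i1 i2,
      integral_sub (hint _) (hint _), integral_sub (hint' _) (hint' _)] at h1
    linarith

lemma integrable_runMax (hX : IsCookieRW P env X) (hX0 : ∀ᵐ ω ∂P, X 0 ω = 1) (n : ℕ) :
    Integrable (fun ω => (runMax X n ω : ℝ)) P := by
  have hm : Measurable[natSA X n] (runMax X n) := measurable_of_history fun _ _ => runMax_congr
  refine Integrable.of_bound (measurable_from_top.comp
    (hm.mono (natSA_le hX.meas n) le_rfl)).aestronglyMeasurable ((n : ℝ) + 1) ?_
  filter_upwards [ae_path hX hX0] with ω ⟨h0, h⟩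
  have h1 : (1 : ℝ) ≤ runMax X n ω := by exact_mod_cast one_le_runMax h0 n
  have h2 : (runMax X n ω : ℝ) ≤ n + 1 := by exact_mod_cast runMax_le_of_path h0 h n
  rw [Real.norm_eq_abs, abs_of_nonneg (by linarith)]
  exact h2

/-- Most sites below the running maximum are used shortly afterwards, if returns are likely. -/
lemma measureReal_le_runMax_mul_le (hX : IsCookieRW P env X) (hX0 : ∀ᵐ ω ∂P, X 0 ω = 1) {ε : ℝ}
    {J : ℕ} (hε : ε ≤ 1) {y : ℤ} (hJ : freshStayProb env y J ≤ ε) (hy : 1 ≤ y) (n : ℕ) :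
    P.real {ω | y ≤ runMax X n ω} * (1 - ε) ≤ P.real {ω | y ∈ usedSites X (n + J) ω} := by
  have hV : ∀ k, MeasurableSet (firstVisit X y k) := fun k =>
    natSA_le hX.meas k _ (measurableSet_firstVisit y k)
  have hS : ∀ k, MeasurableSet (stayEvent X (y - 1) k J) := fun k =>
    natSA_le hX.meas _ _ (measurableSet_stayEvent (y - 1) k J)
  have hdisj : ∀ k l, k < l → Disjoint (firstVisit X y k) (firstVisit X y l) := fun k l hkl =>
    Set.disjoint_left.2 fun ω h1 h2 => by
      have := h2.2 k hkl
      rw [h1.1] at this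
      exact lt_irrefl _ this
  have hpair : Pairwise fun k l => Disjoint (firstVisit X y k) (firstVisit X y l) := fun k l h =>
    (lt_or_gt_of_ne h).elim (hdisj k l) fun h => (hdisj l k h).symm
  have h1 : P.real {ω | y ≤ runMax X n ω} ≤
      P.real (⋃ k ∈ Finset.range (n + 1), firstVisit X y k) := by
    refine ENNReal.toReal_mono (measure_ne_top _ _) (measure_mono_ae ?_)
    filter_upwards [ae_path hX hX0] with ω ⟨h0, h⟩ hω
    obtain ⟨k, hk, hle⟩ := le_runMax_iff.1 hω
    obtain ⟨l, hl, hl'⟩ := exists_firstVisit h0 h hy hle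
    exact Set.mem_iUnion₂.2 ⟨l, by simp; omega, hl'⟩
  have h2 : P.real (⋃ k ∈ Finset.range (n + 1), (firstVisit X y k \ stayEvent X (y - 1) k J)) ≤
      P.real {ω | y ∈ usedSites X (n + J) ω} := by
    refine ENNReal.toReal_mono (measure_ne_top _ _) (measure_mono_ae ?_)
    filter_upwards [ae_path hX hX0] with ω ⟨h0, h⟩ hω
    obtain ⟨k, hk, hω⟩ := Set.mem_iUnion₂.1 hω
    obtain ⟨m, hm, hm'⟩ := mem_usedSites.1 (mem_usedSites_of_return h hω.1.1 hω.2)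
    exact mem_usedSites.2 ⟨m, by simp at hk; omega, hm'⟩
  refine (mul_le_mul_of_nonneg_right h1 (by linarith)).trans (le_trans ?_ h2)
  rw [measureReal_biUnion_finset (fun k _ l _ h => hpair h) fun k _ => hV k,
    measureReal_biUnion_finset
      (fun k _ l _ h => (hpair h).mono Set.sdiff_subset Set.sdiff_subset)
      fun k _ => (hV k).diff (hS k), Finset.sum_mul]
  refine Finset.sum_le_sum fun k _ => ?_
  have h3 := measureReal_inter_stayEvent hX y k J (measurableSet_firstVisit y k) subset_rfl
  have h4 := measureReal_inter_add_sdiff (μ := P) (s := firstVisit X y k) (hS k)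
  have h5 : 0 ≤ P.real (firstVisit X y k) := measureReal_nonneg
  nlinarith

/-- If all returns are likely and the average total drift exceeds `1`, then the expected running
maximum is bounded. -/
lemma integral_runMax_le (hX : IsCookieRW P env X) (hX0 : ∀ᵐ ω ∂P, X 0 ω = 1)
    {N : ℕ} (hN : 1 ≤ N) (hper : ∀ x : ℤ, env (x + N) = env x) {δ ε : ℝ} (hδ : 0 ≤ δ)
    (hsum : δ * N ≤ ∑ x ∈ Finset.Icc (1 : ℤ) N, totalDrift env x) {J : ℕ} (hε : ε ≤ 1)
    (hJ : ∀ y, freshStayProb env y J ≤ ε) (n : ℕ) :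
    (1 - ε) * (δ * (∫ ω, (runMax X n ω : ℝ) ∂P - N)) ≤ ∫ ω, (runMax X n ω : ℝ) ∂P + J := by
  obtain ⟨D, hD⟩ := exists_totalDrift_le hX.envRange hN hper
  have hd := totalDrift_nonneg hX.envRange
  have hint := integrable_runMax hX hX0 n
  have iM : ∀ y : ℤ, Integrable (fun ω => totalDrift env y *
      {ω | y ≤ runMax X n ω}.indicator 1 ω) P := fun y =>
    ((integrable_const (1 : ℝ)).indicator (measurableSet_le_runMax hX y n)).const_mul _
  have iU : ∀ y : ℤ, Integrable (fun ω => totalDrift env y *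
      {ω | y ∈ usedSites X (n + J) ω}.indicator 1 ω) P := fun y =>
    ((integrable_const (1 : ℝ)).indicator (measurableSet_mem_usedSites hX y _)).const_mul _
  have h1 : δ * (∫ ω, (runMax X n ω : ℝ) ∂P - N) ≤
      ∑ y ∈ Finset.Icc (1 : ℤ) (n + 1), totalDrift env y * P.real {ω | y ≤ runMax X n ω} := by
    calc δ * (∫ ω, (runMax X n ω : ℝ) ∂P - N)
        = ∫ ω, δ * ((runMax X n ω : ℝ) - N) ∂P := by
          rw [integral_const_mul, integral_sub hint (integrable_const _)]; simp
      _ ≤ ∫ ω, ∑ y ∈ Finset.Icc (1 : ℤ) (n + 1), totalDrift env y *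
            {ω | y ≤ runMax X n ω}.indicator 1 ω ∂P := by
          refine integral_mono_ae ((hint.sub (integrable_const _)).const_mul _)
            (integrable_finsetSum _ fun y _ => iM y) ?_
          filter_upwards [ae_path hX hX0] with ω ⟨h0, h⟩
          obtain ⟨m, hm⟩ := Int.eq_ofNat_of_zero_le (zero_le_one.trans (one_le_runMax h0 n))
          have hle := runMax_le_of_path h0 h n
          have hs := le_sum_totalDrift hX.envRange hN hper hδ hsum m
          have hf : Finset.Icc (1 : ℤ) m =
              (Finset.Icc (1 : ℤ) (n + 1)).filter (· ≤ runMax X n ω) := by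
            ext z; simp only [Finset.mem_filter, Finset.mem_Icc]; omega
          rw [hf, Finset.sum_filter] at hs
          refine (Eq.le ?_).trans (hs.trans (Eq.le ?_))
          · rw [hm]; simp
          · refine Finset.sum_congr rfl fun y _ => ?_
            simp [Set.indicator]
      _ = _ := by
          rw [integral_finsetSum _ fun y _ => iM y]
          refine Finset.sum_congr rfl fun y _ => ?_
          rw [integral_const_mul, integral_indicator_one (measurableSet_le_runMax hX y n)]
  have h2 : ∑ y ∈ Finset.Icc (1 : ℤ) (n + 1), totalDrift env y *
      P.real {ω | y ∈ usedSites X (n + J) ω} ≤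
      ∫ ω, ∑ y ∈ usedSites X (n + J) ω, totalDrift env y ∂P := by
    calc _ = ∫ ω, ∑ y ∈ Finset.Icc (1 : ℤ) (n + 1), totalDrift env y *
            {ω | y ∈ usedSites X (n + J) ω}.indicator 1 ω ∂P := by
          rw [integral_finsetSum _ fun y _ => iU y]
          refine Finset.sum_congr rfl fun y _ => ?_
          rw [integral_const_mul, integral_indicator_one (measurableSet_mem_usedSites hX y _)]
      _ ≤ _ := by
          refine integral_mono (integrable_finsetSum _ fun y _ => iU y)
            (integrable_sum_totalDrift hX hD _) fun ω => ?_
          have : ∀ y, totalDrift env y * {ω | y ∈ usedSites X (n + J) ω}.indicator 1 ω =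
              if y ∈ usedSites X (n + J) ω then totalDrift env y else 0 := fun y => by
            simp [Set.indicator]
          simp only [this, ← Finset.sum_filter]
          exact Finset.sum_le_sum_of_subset_of_nonneg
            (fun y hy => (Finset.mem_filter.1 hy).2) fun y _ _ => hd y
  have h3 : (1 - ε) * ∑ y ∈ Finset.Icc (1 : ℤ) (n + 1), totalDrift env y *
      P.real {ω | y ≤ runMax X n ω} ≤ ∑ y ∈ Finset.Icc (1 : ℤ) (n + 1), totalDrift env y *
      P.real {ω | y ∈ usedSites X (n + J) ω} := by
    rw [Finset.mul_sum]
    refine Finset.sum_le_sum fun y hy => ?_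
    have := measureReal_le_runMax_mul_le hX hX0 hε (hJ y) (Finset.mem_Icc.1 hy).1 n
    calc _ = totalDrift env y * (P.real {ω | y ≤ runMax X n ω} * (1 - ε)) := by ring
      _ ≤ _ := mul_le_mul_of_nonneg_left this (hd y)
  have h4 : ∫ ω, (X (n + J) ω : ℝ) ∂P ≤ ∫ ω, (runMax X n ω : ℝ) ∂P + J := by
    have : ∫ ω, ((runMax X n ω : ℝ) + J) ∂P = ∫ ω, (runMax X n ω : ℝ) ∂P + J := by
      rw [integral_add hint (integrable_const _)]; simp
    rw [← this]
    refine integral_mono_ae (integrable_position hX hX0 _) (hint.add (integrable_const _)) ?_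
    filter_upwards [ae_path hX hX0] with ω ⟨_, h⟩
    have h5 := le_add_of_path h n J
    have h6 : X n ω ≤ runMax X n ω := le_runMax_iff.2 ⟨n, le_rfl, le_rfl⟩
    have : X (n + J) ω ≤ runMax X n ω + J := by omega
    show (X (n + J) ω : ℝ) ≤ runMax X n ω + J
    exact_mod_cast this
  have h5 := integral_position hX hX0 hD (n + J)
  have h6 := mul_le_mul_of_nonneg_left h1 (by linarith : (0 : ℝ) ≤ 1 - ε)
  linarith

/-- The expected running maximum is unbounded. -/
lemma exists_lt_integral_runMax (hX : IsCookieRW P env X) (hX0 : ∀ᵐ ω ∂P, X 0 ω = 1) (C : ℝ) :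
    ∃ n, C < ∫ ω, (runMax X n ω : ℝ) ∂P := by
  by_contra! hC
  obtain ⟨K, hK⟩ := exists_nat_gt (max C 0)
  have hle : ∀ n, (K : ℝ) * P.real {ω | (K : ℤ) ≤ runMax X n ω} ≤ C := fun n => by
    refine le_trans ?_ (hC n)
    rw [← integral_indicator_one (measurableSet_le_runMax hX K n), ← integral_const_mul]
    refine integral_mono_ae
      (((integrable_const (1 : ℝ)).indicator (measurableSet_le_runMax hX K n)).const_mul _)
      (integrable_runMax hX hX0 n) ?_
    filter_upwards [hX0] with ω h0
    have h1 : (1 : ℝ) ≤ runMax X n ω := by exact_mod_cast one_le_runMax h0 n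
    by_cases h : (K : ℤ) ≤ runMax X n ω
    · have : (K : ℝ) ≤ runMax X n ω := by exact_mod_cast h
      simpa [Set.indicator, h] using this
    · simp only [Set.indicator, Set.mem_ofPred_eq, h, if_false]
      linarith
  have hmono : Monotone fun n => {ω | (K : ℤ) ≤ runMax X n ω} :=
    monotone_nat_of_le_succ fun n ω (h : (K : ℤ) ≤ _) => h.trans (le_max_left _ _)
  have hone : P (⋃ n, {ω | (K : ℤ) ≤ runMax X n ω}) = 1 := by
    rw [← mem_ae_iff_prob_eq_one₀ (MeasurableSet.iUnion fun n =>
      measurableSet_le_runMax hX K n).nullMeasurableSet]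
    filter_upwards [ae_unbounded hX hX0] with ω h
    obtain ⟨n, hn⟩ := h K
    exact Set.mem_iUnion.2 ⟨n, le_runMax_iff.2 ⟨n, le_rfl, hn⟩⟩
  have hlim := (ENNReal.tendsto_toReal (measure_ne_top P _)).comp
    (tendsto_measure_iUnion_atTop (μ := P) hmono)
  rw [hone, ENNReal.toReal_one] at hlim
  have := le_of_tendsto (hlim.const_mul (K : ℝ)) (Eventually.of_forall hle)
  have := le_max_left C 0
  linarith

/-- The probability that a fresh walk started at `y` stays above `y - 1` is bounded below, uniformly
in `y`. -/
lemma exists_freshStayProb_pos (hX : IsCookieRW P env X) (hX0 : ∀ᵐ ω ∂P, X 0 ω = 1)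
    {N : ℕ} (hN : 1 ≤ N) (hper : ∀ x : ℤ, env (x + N) = env x)
    (hsum : (N : ℝ) < ∑ x ∈ Finset.Icc (1 : ℤ) N, totalDrift env x) :
    ∃ c > 0, ∀ y n, c ≤ freshStayProb env y n := by
  by_contra hcon
  have hret : ∀ ε > 0, ∀ a, ∃ n, freshStayProb env a n ≤ ε := fun ε hε a => by
    by_contra! h
    exact hcon (exists_pos_le_freshStayProb hX.envRange hN hper hε fun n => (h n).le)
  have hN0 : (0 : ℝ) < N := by exact_mod_cast hN
  obtain ⟨δ, hδ⟩ : ∃ δ, δ = (∑ x ∈ Finset.Icc (1 : ℤ) N, totalDrift env x) / N := ⟨_, rfl⟩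
  have hδ1 : 1 < δ := by rw [hδ, one_lt_div hN0]; exact hsum
  have hδN : δ * N ≤ ∑ x ∈ Finset.Icc (1 : ℤ) N, totalDrift env x := by
    rw [hδ, div_mul_cancel₀ _ hN0.ne']
  obtain ⟨ε, hε⟩ : ∃ ε, ε = (δ - 1) / (2 * δ) := ⟨_, rfl⟩
  have hε0 : 0 < ε := by rw [hε]; apply div_pos <;> linarith
  have hεδ : (1 - ε) * δ = (δ + 1) / 2 := by rw [hε]; field_simp; ring
  have hε1 : ε ≤ 1 := by rw [hε, div_le_one (by linarith)]; linarith
  obtain ⟨J, hJ⟩ := exists_freshStayProb_le hX.envRange hN hper (hret ε hε0)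
  obtain ⟨n, hn⟩ := exists_lt_integral_runMax hX hX0 ((J + (δ + 1) / 2 * N) / ((δ - 1) / 2))
  rw [div_lt_iff₀ (by linarith)] at hn
  have := integral_runMax_le hX hX0 hN hper (by linarith) hδN hε1 hJ n
  rw [← mul_assoc, hεδ] at this
  linarith

/-- Once the walk is at a new maximum `y`, it stays above `y - 1` forever with probability
bounded below. -/
lemma mul_measureReal_le_inter_iInter (hX : IsCookieRW P env X) {c : ℝ} {y : ℤ}
    (hc : ∀ n, c ≤ freshStayProb env y n) {k : ℕ} {s : Set Ω} (hs : MeasurableSet[natSA X k] s)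
    (hsub : s ⊆ firstVisit X y k) :
    c * P.real s ≤ P.real (s ∩ {ω | ∀ i, y ≤ X (k + i) ω}) := by
  have hS : ∀ n, MeasurableSet (s ∩ stayEvent X (y - 1) k n) := fun n =>
    (natSA_le hX.meas k s hs).inter (natSA_le hX.meas _ _ (measurableSet_stayEvent (y - 1) k n))
  have hanti : Antitone fun n => s ∩ stayEvent X (y - 1) k n := fun m n hmn ω h =>
    ⟨h.1, fun i hi => h.2 i (hi.trans hmn)⟩
  have heq : ⋂ n, s ∩ stayEvent X (y - 1) k n = s ∩ {ω | ∀ i, y ≤ X (k + i) ω} := by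
    ext ω
    simp only [Set.mem_iInter, Set.mem_inter_iff, stayEvent, Set.mem_ofPred_eq]
    constructor
    · exact fun h => ⟨(h 0).1, fun i => by have := (h i).2 i le_rfl; omega⟩
    · exact fun h n => ⟨h.1, fun i _ => by have := h.2 i; omega⟩
  have hlim := (ENNReal.tendsto_toReal (measure_ne_top P _)).comp
    (tendsto_measure_iInter_atTop (μ := P) (fun n => (hS n).nullMeasurableSet) hanti
      ⟨0, measure_ne_top _ _⟩)
  rw [heq] at hlim
  refine ge_of_tendsto hlim (Eventually.of_forall fun n => ?_)
  have h := measureReal_inter_stayEvent hX y k n hs hsub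
  show c * P.real s ≤ P.real (s ∩ stayEvent X (y - 1) k n)
  rw [h, mul_comm]
  exact mul_le_mul_of_nonneg_left (hc n) measureReal_nonneg

lemma measure_hitTime_eq_top_pos (hX : IsCookieRW P env X) (hX0 : ∀ᵐ ω ∂P, X 0 ω = 1) {c : ℝ}
    (hc0 : 0 < c) (hc : ∀ n, c ≤ freshStayProb env 1 n) : 0 < P {ω | hitTime X 0 ω = ⊤} := by
  have h := mul_measureReal_le_inter_iInter hX hc (measurableSet_firstVisit 1 0) subset_rfl
  have h1 : P.real (firstVisit X 1 0) = 1 := by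
    have : P (firstVisit X 1 0) = 1 := by
      rw [← mem_ae_iff_prob_eq_one₀ (natSA_le hX.meas 0 _
        (measurableSet_firstVisit 1 0)).nullMeasurableSet]
      filter_upwards [hX0] with ω h
      exact ⟨h, by simp⟩
    simp [measureReal_def, this]
  rw [h1, mul_one] at h
  have h2 : 0 < P (firstVisit X 1 0 ∩ {ω | ∀ i, 1 ≤ X (0 + i) ω}) :=
    pos_iff_ne_zero.2 fun h0 => by
      rw [measureReal_def, h0, ENNReal.toReal_zero] at h
      linarith
  refine h2.trans_le (measure_mono fun ω hω => hitTime_eq_top fun n => ?_)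
  have := hω.2 n
  rw [zero_add] at this
  omega

lemma ae_tendsto_atTop (hX : IsCookieRW P env X) (hX0 : ∀ᵐ ω ∂P, X 0 ω = 1) {c : ℝ}
    (hc0 : 0 < c) (hc : ∀ y n, c ≤ freshStayProb env y n) :
    ∀ᵐ ω ∂P, Tendsto (fun n => X n ω) atTop atTop := by
  suffices h : ∀ L : ℤ, ∀ᵐ ω ∂P, ∀ᶠ n in atTop, L ≤ X n ω by
    filter_upwards [ae_all_iff.2 h] with ω hω
    exact tendsto_atTop.2 hω
  intro L
  let ℱ := natFiltration hX.meas
  let B : Set Ω := {ω | ∀ᶠ n in atTop, L ≤ X n ω}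
  have hBsup : MeasurableSet[⨆ n, ℱ n] B := by
    have heq : B = ⋃ k, ⋂ n, ⋂ _ : k ≤ n, {ω | L ≤ X n ω} := by
      ext ω; simp [B, eventually_atTop]
    rw [heq]
    refine MeasurableSet.iUnion fun k => MeasurableSet.iInter fun n => MeasurableSet.iInter fun _ => ?_
    have hle : natSA X n ≤ ⨆ n, ℱ n := le_iSup (fun n => ℱ n) n
    exact hle _ (measurableSet_of_history fun ω ω' h => by
      simp only [Set.mem_ofPred_eq, h n le_rfl])
  have hB : MeasurableSet B := iSup_le (fun n => natSA_le hX.meas n) _ hBsup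
  have hBint : Integrable (B.indicator fun _ => (1 : ℝ)) P := (integrable_const _).indicator hB
  have hlevy := hBint.tendsto_ae_condExp (ℱ := ℱ)
    ((@stronglyMeasurable_const _ _ (⨆ n, ℱ n) _ 1).indicator hBsup)
  have hlow : ∀ᵐ ω ∂P, ∀ (y : ℤ) (k : ℕ), L ≤ y → ω ∈ firstVisit X y k →
      c ≤ (P[B.indicator fun _ => (1 : ℝ) | ℱ k]) ω := by
    refine ae_all_iff.2 fun y => ae_all_iff.2 fun k => ?_
    by_cases hy : L ≤ y
    swap
    · exact ae_of_all _ fun ω h => absurd h hy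
    let g := P[B.indicator fun _ => (1 : ℝ) | ℱ k]
    let s := firstVisit X y k ∩ {ω | g ω < c}
    have hg : StronglyMeasurable[natSA X k] g := stronglyMeasurable_condExp
    have hs : MeasurableSet[natSA X k] s :=
      (measurableSet_firstVisit y k).inter (hg.measurable measurableSet_Iio)
    have hs' := natSA_le hX.meas k s hs
    have h1 := mul_measureReal_le_inter_iInter hX (hc y) hs Set.inter_subset_left
    have h2 : P.real (s ∩ {ω | ∀ i, y ≤ X (k + i) ω}) ≤ P.real (s ∩ B) := by
      refine measureReal_mono fun ω hω => ⟨hω.1, ?_⟩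
      refine eventually_atTop.2 ⟨k, fun n hn => ?_⟩
      have := hω.2 (n - k)
      rw [Nat.add_sub_cancel' hn] at this
      exact hy.trans this
    have h3 : ∫ ω in s, g ω ∂P = P.real (s ∩ B) := by
      refine (setIntegral_condExp (ℱ.le k) hBint hs).trans ?_
      rw [setIntegral_indicator hB]
      simp
    have h4 : ∫ ω in s, (c - g ω) ∂P ≤ 0 := by
      rw [integral_sub (integrable_const _) integrable_condExp.integrableOn, h3]
      simp only [integral_const, measureReal_restrict_apply_univ, smul_eq_mul]
      linarith
    have h5 : P s = 0 := by
      by_contra h0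
      have : 0 < ∫ ω in s, (c - g ω) ∂P := by
        rw [setIntegral_pos_iff_support_of_nonneg_ae]
        · refine (pos_iff_ne_zero.2 h0).trans_le (measure_mono fun ω hω => ⟨?_, hω⟩)
          have : g ω < c := hω.2
          exact (sub_pos.2 this).ne'
        · filter_upwards [ae_restrict_mem hs'] with ω hω
          have : g ω < c := hω.2
          exact (sub_pos.2 this).le
        · exact (integrable_const _).sub integrable_condExp.integrableOn
      linarith
    filter_upwards [measure_eq_zero_iff_ae_notMem.1 h5] with ω hω _ hV
    by_contra! hlt
    exact hω ⟨hV, hlt⟩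
  filter_upwards [hlevy, hlow, ae_unbounded hX hX0, ae_path hX hX0] with ω h1 h2 h3 ⟨h0, hpath⟩
  by_contra hω
  have hω' : ω ∉ B := hω
  rw [Set.indicator_of_notMem hω'] at h1
  obtain ⟨n₀, hn₀⟩ := eventually_atTop.1 (h1.eventually_lt_const hc0)
  obtain ⟨n, hn⟩ := h3 (max L (n₀ + 2))
  obtain ⟨k, -, hk⟩ := exists_firstVisit h0 hpath (by omega) hn
  have hk0 : n₀ ≤ k := by
    have := le_add_of_path hpath 0 k
    rw [zero_add, h0, hk.1] at this
    omega
  exact (hn₀ k hk0).not_ge (h2 _ k (le_max_left _ _) hk)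

end Walk

/-- In a periodic environment with `(1/N)·Σ_{x=1}^{N} ω(x)/(1-ω(x)) > 2`, the walk started
at `1` never hits `0` with positive probability and tends to `+∞` almost surely. -/
theorem stmt6 (env : ℤ → ℝ) (henv : ∀ x : ℤ, env x ∈ Set.Ico (1 / 2 : ℝ) 1)
    (N : ℕ) (hN : 1 ≤ N) (hper : ∀ x : ℤ, env (x + N) = env x)
    (hsum : 2 < (1 / (N : ℝ)) * ∑ x ∈ Finset.Icc (1 : ℤ) (N : ℤ), env x / (1 - env x))
    {Ω : Type*} [MeasurableSpace Ω] (P : Measure Ω) [IsProbabilityMeasure P]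
    (X : ℕ → Ω → ℤ) (hX : IsCookieRW P env X) (hX0 : ∀ᵐ ω ∂P, X 0 ω = 1) :
    0 < P {ω | hitTime X 0 ω = ⊤} ∧
    ∀ᵐ ω ∂P, Tendsto (fun n => X n ω) atTop atTop := by
  have hN0 : (0 : ℝ) < N := by exact_mod_cast hN
  have hsum' : (N : ℝ) < ∑ x ∈ Finset.Icc (1 : ℤ) N, totalDrift env x := by
    rw [sum_totalDrift_Icc henv]
    rw [one_div, inv_mul_eq_div, lt_div_iff₀ hN0] at hsum
    linarith
  obtain ⟨c, hc0, hc⟩ := exists_freshStayProb_pos hX hX0 hN hper hsum'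
  exact ⟨measure_hitTime_eq_top_pos hX hX0 hc0 (hc 1), ae_tendsto_atTop hX hX0 hc0 hc⟩
end
end
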